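/- There exists an absolute constant $\mathcal C>0$ with the following property. Consider inputs in $\mathbb R^d$, $C\ge 2$ classes, and two-layer networks $F_{\mathcal A}(x)=A^2\sigma(\tilde A^1x)$, $\mathcal A=(A^1,A^2)$. The first layer is convolutional: each of the $m$ filters (the rows of $A^1$) is applied to each of $P$ fixed patches of $x$ (tuples of coordinates of $x$, all of the same length), and $\tilde A^1x\in\mathbb R^{m\times P}$ collects the resulting $\bar W=mP$ values. The nonlinearity $\sigma:\mathbb R^{m\times P}\to\mathbb R^{m\times w}$ is coordinatewise ReLU followed by spatial max-pooling: within each channel, the maximum is taken over each of $w$ nonempty, pairwise disjoint windows of the $P$ spatial positions, the windows being the same for all channels. The second layer is fully connected with matrix $A^2\in\mathbb R^{C\times mw}$. Write $|x|_0$ for the maximum Euclidean norm of a single patch of $x$, $\|A^\top\|_{2,1}$ for the sum of the Euclidean norms of the rows of $A$, and $\widehat R_\gamma(F)=\frac1n\#\{i\le n: F(x_i)_{y_i}\le\gamma+\max_{j\ne y_i}F(x_i)_j\}$. Fix reference matrices $M^1,M^2$ of the shapes of $A^1,A^2$. Let $a_1,a_2,a_*,b_0,b_1,\gamma>0$, $\delta\in(0,1)$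 and $n\ge1$. Suppose $(x,y),(x_1,y_1),\dots,(x_n,y_n)$ are drawn i.i.d. from a probability distribution on $\mathbb R^d\times\{1,\dots,C\}$ such that $|x|_0\le b_0$ almost surely. Then with probability greater than $1-\delta$ over the draw of the training set $(x_i,y_i)_{i\le n}$, every network $\mathcal A=(A^1,A^2)$ with $\|(A^1-M^1)^\top\|_{2,1}\le a_1$, $\|A^2-M^2\|_{\mathrm{Fr}}\le a_2$, $\sup_{c\le C}\|A^2_{c,\cdot}\|_2\le a_*$ and $\sup_{i\le n}\|\tilde A^1x_i\|_{\mathrm{Fr}}\le b_1$ satisfies $$\mathbb P\Big(\operatorname*{argmax}_jF_{\mathcal A}(x)_j\ne y\Big)\le\widehat R_\gamma(F_{\mathcal A})+3\sqrt{\frac{\log(2/\delta)}{2n}}+\frac{\mathcal C}{\sqrt n}\,\mathcal R\,\big[\max(0,\log_2(n^2\mathcal D))\big]^{1/2}\log(n),$$ where a tie for the maximum counts as an error on the left-hand side, and $$\mathcal R^{2/3}=\Big[b_0a_1\max\Big(\frac1{b_1},\frac{\sqrt w\,a_*}{\gamma}\Big)\Big]^{2/3}+\Big[\frac{b_1a_2}{\gamma}\Big]^{2/3},\qquad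 \mathcal D=\max\Big(b_0a_1\bar W\max\Big(\frac1{b_1},\frac{\sqrt w\,a_*}{\gamma}\Big),\ \frac{b_1a_2C}{\gamma}\Big).$$ -/

import Mathlib

open MeasureTheory

namespace TwoLayerConv

/-- The pooling windows of a spatial max-pooling from `P` spatial positions to `w` positions:
nonempty, pairwise disjoint sets of positions. The same windows are used in every channel, so
pooling never mixes channels; singletons give a layer without pooling. -/
structure Pooling (P w : ℕ) where
  window : Fin w → Finset (Fin P)
  nonempty : ∀ j, (window j).Nonempty
  disjoint : ∀ j j', j ≠ j' → Disjoint (window j) (window j')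

/-- The convolution `Ã¹x`: each of the `m` filters (the rows of `A1`) is applied to each of the
`P` patches of the input, `pt o i` being the `i`-th coordinate of the `o`-th patch. -/
def conv {d m dp P : ℕ} (pt : Fin P → Fin dp → Fin d)
    (A1 : Matrix (Fin m) (Fin dp) ℝ) (x : Fin d → ℝ) : Fin m → Fin P → ℝ :=
  fun f o => ∑ i, x (pt o i) * A1 f i

/-- `|x|₀`, the largest Euclidean norm of a single convolutional patch of `x`. -/
noncomputable def patchNorm {d dp P : ℕ} (pt : Fin P → Fin dp → Fin d) (x : Fin d → ℝ) : ℝ :=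
  ⨆ o : Fin P, Real.sqrt (∑ i, x (pt o i) ^ 2)

/-- The nonlinearity `σ`: coordinatewise ReLU followed by spatial max-pooling. -/
noncomputable def reluPool {m P w : ℕ} (pool : Pooling P w) (z : Fin m → Fin P → ℝ) :
    Fin m → Fin w → ℝ :=
  fun f j => (pool.window j).sup' (pool.nonempty j) fun o => max (z f o) 0

/-- The network `F(x) = A²σ(Ã¹x)`; the columns of `A²` are indexed by the hidden neurons after
pooling, that is by (channel, spatial position). -/
noncomputable def net {d m dp P w C : ℕ} (pt : Fin P → Fin dp → Fin d) (pool : Pooling P w)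
    (A1 : Matrix (Fin m) (Fin dp) ℝ) (A2 : Matrix (Fin C) (Fin m × Fin w) ℝ)
    (x : Fin d → ℝ) : Fin C → ℝ :=
  A2.mulVec fun q => reluPool pool (conv pt A1 x) q.1 q.2

/-- Euclidean norm of a finite family of reals. -/
noncomputable def l2 {ι : Type*} [Fintype ι] (v : ι → ℝ) : ℝ :=
  Real.sqrt (∑ i, v i ^ 2)

/-- Frobenius norm. -/
noncomputable def frob {ι κ : Type*} [Fintype ι] [Fintype κ] (A : ι → κ → ℝ) : ℝ :=
  Real.sqrt (∑ i, ∑ k, A i k ^ 2)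

/-- `‖Aᵀ‖_{2,1}`, the sum of the Euclidean norms of the rows of `A`. -/
noncomputable def rowSum21 {ι κ : Type*} [Fintype ι] [Fintype κ] (A : Matrix ι κ ℝ) : ℝ :=
  ∑ i, l2 (A i)

/-- The event `argmax_j F(x)_j ≠ y`; a tie for the maximum counts as an error. -/
def errorSet {d C : ℕ} (F : (Fin d → ℝ) → Fin C → ℝ) : Set ((Fin d → ℝ) × Fin C) :=
  {p | ∃ c, c ≠ p.2 ∧ F p.1 p.2 ≤ F p.1 c}

/-- The empirical margin risk
`R̂_γ(F) = (1/n) #{i : F(x_i)_{y_i} ≤ γ + max_{j ≠ y_i} F(x_i)_j}`. -/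
noncomputable def marginRisk {d C n : ℕ} (γ : ℝ) (F : (Fin d → ℝ) → Fin C → ℝ)
    (s : Fin n → (Fin d → ℝ) × Fin C) : ℝ :=
  (Set.ncard {i : Fin n |
    F (s i).1 (s i).2 ≤ γ + ⨆ c : {c : Fin C // c ≠ (s i).2}, F (s i).1 c} : ℝ) / n

/-- The capacity `𝓡`. -/
noncomputable def capacity (w : ℕ) (a₁ a₂ aStar b₀ b₁ γ : ℝ) : ℝ :=
  ((b₀ * a₁ * max (1 / b₁) (Real.sqrt w * aStar / γ)) ^ ((2 : ℝ) / 3) +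
    (b₁ * a₂ / γ) ^ ((2 : ℝ) / 3)) ^ ((3 : ℝ) / 2)

/-- The quantity `𝒟` in the logarithm, `Wbar` being the number of hidden neurons before
pooling. -/
noncomputable def logArg (w C Wbar : ℕ) (a₁ a₂ aStar b₀ b₁ γ : ℝ) : ℝ :=
  max (b₀ * a₁ * Wbar * max (1 / b₁) (Real.sqrt w * aStar / γ)) (b₁ * a₂ * C / γ)

end TwoLayerConv

open TwoLayerConv

namespace TwoLayerConv

/-- Hoeffding's lemma for a function of bounded oscillation. -/
theorem integral_exp_le_of_oscillation {Ω : Type*} [MeasurableSpace Ω] (μ : Measure Ω)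
    [IsProbabilityMeasure μ] (g : Ω → ℝ) (hg : Measurable g) (c : ℝ)
    (hosc : ∀ x x', g x - g x' ≤ c) :
    ∫ x, Real.exp (g x) ∂μ ≤ Real.exp (∫ x, g x ∂μ + c ^ 2 / 8) := by
  obtain ⟨x₀⟩ : Nonempty Ω := nonempty_of_isProbabilityMeasure μ
  have hc : 0 ≤ c := by simpa using hosc x₀ x₀
  have hbdd : BddBelow (Set.range g) :=
    ⟨g x₀ - c, by rintro _ ⟨x, rfl⟩; linarith [hosc x₀ x]⟩
  have hmem : ∀ x, g x ∈ Set.Icc (⨅ y, g y) ((⨅ y, g y) + c) := by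
    intro x
    have : Nonempty Ω := ⟨x₀⟩
    refine ⟨ciInf_le hbdd x, ?_⟩
    have : g x - c ≤ ⨅ y, g y := le_ciInf fun y => by linarith [hosc x y]
    linarith
  have hsub := (ProbabilityTheory.hasSubgaussianMGF_of_mem_Icc (μ := μ) hg.aemeasurable
    (Filter.Eventually.of_forall hmem)).mgf_le 1
  simp only [ProbabilityTheory.mgf, one_mul, add_sub_cancel_left, one_pow, mul_one] at hsub
  have hsplit : ∀ x, Real.exp (g x) = Real.exp (∫ y, g y ∂μ) * Real.exp (g x - ∫ y, g y ∂μ) := by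
    intro x; rw [← Real.exp_add]; ring_nf
  simp_rw [hsplit]
  rw [integral_const_mul, Real.exp_add]
  gcongr
  refine hsub.trans (le_of_eq ?_)
  congr 1
  simp [abs_of_nonneg hc]
  ring

theorem integrable_of_abs_le {Ω : Type*} [MeasurableSpace Ω] {μ : Measure Ω}
    [IsFiniteMeasure μ] {g : Ω → ℝ} (hg : Measurable g) (B : ℝ) (hB : ∀ x, |g x| ≤ B) :
    Integrable g μ :=
  Integrable.of_bound hg.aestronglyMeasurable B (Filter.Eventually.of_forall hB)

/-- The moment generating function bound behind McDiarmid's inequality. -/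
theorem integral_exp_le_of_bounded_differences {Ω : Type*} [MeasurableSpace Ω] (μ : Measure Ω)
    [IsProbabilityMeasure μ] (c B : ℝ) (n : ℕ) (f : (Fin n → Ω) → ℝ) (hf : Measurable f)
    (hB : ∀ s, |f s| ≤ B)
    (hdiff : ∀ s i x, f s - f (Function.update s i x) ≤ c) :
    ∫ s, Real.exp (f s) ∂(Measure.pi fun _ => μ) ≤
      Real.exp (∫ s, f s ∂(Measure.pi fun _ => μ) + n * c ^ 2 / 8) := by
  induction n with
  | zero =>
    have h : ∀ s, f s = f default := fun s => congrArg f (Subsingleton.elim _ _)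
    simp_rw [h]
    simp
  | succ n ih =>
    have hmp := (measurePreserving_piFinSuccAbove (fun _ : Fin (n + 1) => μ) 0).symm
    have hm := (MeasurableEquiv.piFinSuccAbove (fun _ : Fin (n + 1) => Ω) 0).symm.measurable
    set e := (MeasurableEquiv.piFinSuccAbove (fun _ : Fin (n + 1) => Ω) 0).symm with he
    have hea : ∀ x s, e (x, s) = Fin.cons x s := fun x s => by
      simp [he, MeasurableEquiv.piFinSuccAbove, Fin.insertNthEquiv]
    rw [← hmp.integral_comp', ← hmp.integral_comp']
    have hfe : Measurable fun p => f (e p) := hf.comp hm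
    have hint : Integrable (fun p => f (e p)) (μ.prod (Measure.pi fun _ : Fin n => μ)) :=
      integrable_of_abs_le hfe B fun p => hB _
    have hint' : Integrable (fun p => Real.exp (f (e p)))
        (μ.prod (Measure.pi fun _ : Fin n => μ)) :=
      integrable_of_abs_le hfe.exp (Real.exp B) fun p => by
        rw [abs_of_pos (Real.exp_pos _)]
        exact Real.exp_le_exp.2 ((le_abs_self _).trans (hB _))
    have e1 := integral_prod _ hint
    have e2 := integral_prod _ hint'
    change ∫ p, Real.exp (f (e p)) ∂(μ.prod (Measure.pi fun _ : Fin n => μ)) ≤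
      Real.exp (∫ p, f (e p) ∂(μ.prod (Measure.pi fun _ : Fin n => μ)) + _)
    rw [e1, e2]
    set g : Ω → ℝ := fun x => ∫ s, f (e (x, s)) ∂(Measure.pi fun _ : Fin n => μ) with hgdef
    have hgm : Measurable g := (hfe.stronglyMeasurable.integral_prod_right').measurable
    have hsec : ∀ x, Measurable fun s => f (e (x, s)) := fun x => hfe.comp measurable_prodMk_left
    have hsint : ∀ x, Integrable (fun s => f (e (x, s))) (Measure.pi fun _ : Fin n => μ) :=
      fun x => integrable_of_abs_le (hsec x) B fun s => hB _
    have hgb : ∀ x, |g x| ≤ B := fun x => by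
      have := norm_integral_le_of_norm_le_const (μ := Measure.pi fun _ : Fin n => μ)
        (f := fun s => f (e (x, s))) (C := B) (Filter.Eventually.of_forall fun s => hB _)
      simpa using this
    have hosc : ∀ x x', g x - g x' ≤ c := fun x x' => by
      rw [hgdef]
      simp only
      rw [← integral_sub (hsint x) (hsint x')]
      have : ∀ s, f (e (x, s)) - f (e (x', s)) ≤ c := fun s => by
        have := hdiff (e (x, s)) 0 x'
        rwa [hea, hea, Fin.update_cons_zero] at *
      calc ∫ s, (f (e (x, s)) - f (e (x', s))) ∂(Measure.pi fun _ : Fin n => μ)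
          ≤ ∫ s, c ∂(Measure.pi fun _ : Fin n => μ) :=
            integral_mono ((hsint x).sub (hsint x')) (integrable_const _) this
        _ = c := by simp
    have hinner : ∀ x, ∫ s, Real.exp (f (e (x, s))) ∂(Measure.pi fun _ : Fin n => μ) ≤
        Real.exp (g x) * Real.exp (n * c ^ 2 / 8) := fun x => by
      rw [← Real.exp_add]
      refine ih _ (hsec x) (fun s => hB _) fun s i y => ?_
      have := hdiff (e (x, s)) i.succ y
      rwa [hea, ← Fin.cons_update, ← hea, ← hea] at this
    have hge : Integrable (fun x => Real.exp (g x)) μ :=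
      integrable_of_abs_le hgm.exp (Real.exp B) fun p => by
        rw [abs_of_pos (Real.exp_pos _)]
        exact Real.exp_le_exp.2 ((le_abs_self _).trans (hgb _))
    calc ∫ x, ∫ s, Real.exp (f (e (x, s))) ∂(Measure.pi fun _ : Fin n => μ) ∂μ
        ≤ ∫ x, Real.exp (g x) * Real.exp (n * c ^ 2 / 8) ∂μ :=
          integral_mono hint'.integral_prod_left (hge.mul_const _) hinner
      _ = (∫ x, Real.exp (g x) ∂μ) * Real.exp (n * c ^ 2 / 8) := integral_mul_const _ _
      _ ≤ Real.exp (∫ x, g x ∂μ + c ^ 2 / 8) * Real.exp (n * c ^ 2 / 8) := by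
          gcongr
          exact integral_exp_le_of_oscillation μ g hgm c hosc
      _ = _ := by
          rw [← Real.exp_add]
          congr 1
          push_cast
          ring

/-- McDiarmid's inequality with all differences bounded by `1 / n`. -/
theorem measure_ge_le_of_bounded_differences {Ω : Type*} [MeasurableSpace Ω] (μ : Measure Ω)
    [IsProbabilityMeasure μ] (B : ℝ) (n : ℕ) (hn : 0 < n) (f : (Fin n → Ω) → ℝ)
    (hf : Measurable f) (hB : ∀ s, |f s| ≤ B)
    (hdiff : ∀ s i x, f s - f (Function.update s i x) ≤ 1 / n) (t : ℝ) (ht : 0 ≤ t) :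
    (Measure.pi fun _ => μ).real {s | ∫ s, f s ∂(Measure.pi fun _ => μ) + t ≤ f s} ≤
      Real.exp (-(2 * n * t ^ 2)) := by
  set ν : Measure (Fin n → Ω) := Measure.pi fun _ => μ with hν
  have hn' : (0 : ℝ) < n := by exact_mod_cast hn
  set l : ℝ := 4 * n * t with hl
  have hl0 : 0 ≤ l := by positivity
  have hmgf := integral_exp_le_of_bounded_differences μ (l * (1 / n)) (l * B) n
    (fun s => l * f s) (hf.const_mul l)
    (fun s => by rw [abs_mul, abs_of_nonneg hl0]; exact mul_le_mul_of_nonneg_left (hB s) hl0)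
    (fun s i x => by
      rw [← mul_sub]; exact mul_le_mul_of_nonneg_left (hdiff s i x) hl0)
  rw [← hν, integral_const_mul] at hmgf
  have hint : Integrable (fun s => Real.exp (l * f s)) ν :=
    integrable_of_abs_le (hf.const_mul l).exp (Real.exp (l * B)) fun p => by
      rw [abs_of_pos (Real.exp_pos _)]
      exact Real.exp_le_exp.2 (mul_le_mul_of_nonneg_left ((le_abs_self _).trans (hB _)) hl0)
  have hch := ProbabilityTheory.measure_ge_le_exp_mul_mgf (μ := ν) (X := f) (t := l)
    (∫ s, f s ∂ν + t) hl0 hint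
  refine hch.trans ?_
  rw [ProbabilityTheory.mgf]
  refine (mul_le_mul_of_nonneg_left hmgf (Real.exp_pos _).le).trans ?_
  rw [← Real.exp_add]
  refine Real.exp_le_exp.2 (le_of_eq ?_)
  rw [hl]
  field_simp
  ring

/-- The sign `±1` attached to a Boolean. -/
noncomputable def boolSign (b : Bool) : ℝ := if b then 1 else -1

theorem abs_boolSign (b : Bool) : |boolSign b| = 1 := by
  cases b <;> simp [boolSign]

theorem sum_exp_signed_le {n : ℕ} (l r : ℝ) (v : Fin n → ℝ) (hv : ∀ k, |v k| ≤ r) :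
    ∑ ε : Fin n → Bool, Real.exp (l * ∑ k, boolSign (ε k) * v k) ≤
      2 ^ n * Real.exp (l ^ 2 * (n * r ^ 2) / 2) := by
  have h1 : ∀ ε : Fin n → Bool, Real.exp (l * ∑ k, boolSign (ε k) * v k) =
      ∏ k, Real.exp (l * (boolSign (ε k) * v k)) := fun ε => by
    rw [Finset.mul_sum, Real.exp_sum]
  have h2 := Finset.prod_univ_sum (fun _ : Fin n => (Finset.univ : Finset Bool))
    (fun k b => Real.exp (l * (boolSign b * v k)))
  rw [Fintype.piFinset_univ] at h2
  simp_rw [h1]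
  rw [← h2]
  calc ∏ k, ∑ b, Real.exp (l * (boolSign b * v k))
      ≤ ∏ _k : Fin n, 2 * Real.exp (l ^ 2 * r ^ 2 / 2) := by
        refine Finset.prod_le_prod (fun k _ => Finset.sum_nonneg fun _ _ => (Real.exp_pos _).le) ?_
        intro k _
        have hc := Real.cosh_le_exp_half_sq (l * v k)
        have hs : ∑ b, Real.exp (l * (boolSign b * v k)) = 2 * Real.cosh (l * v k) := by
          rw [Real.cosh_eq]
          simp [boolSign]
          ring
        rw [hs]
        refine mul_le_mul_of_nonneg_left (hc.trans (Real.exp_le_exp.2 ?_)) (by norm_num)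
        have : v k ^ 2 ≤ r ^ 2 := sq_le_sq' (abs_le.1 (hv k)).1 (abs_le.1 (hv k)).2
        rw [mul_pow]
        gcongr
    _ = _ := by
        rw [Finset.prod_const, Finset.card_univ, Fintype.card_fin, mul_pow, ← Real.exp_nat_mul]
        congr 2
        ring

/-- Massart's finite class lemma, for an arbitrary sign-dependent selection from the class. -/
theorem sum_signed_selection_le {n : ℕ} (V : Finset (Fin n → ℝ)) (Λ r : ℝ) (hΛ : 0 < Λ)
    (hr : 0 ≤ r) (hcard : (V.card : ℝ) ≤ Real.exp Λ) (hV : ∀ v ∈ V, ∀ k, |v k| ≤ r)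
    (sel : (Fin n → Bool) → Fin n → ℝ) (hsel : ∀ ε, sel ε ∈ V) :
    ∑ ε : Fin n → Bool, ∑ k, boolSign (ε k) * sel ε k ≤ 2 ^ n * (r * Real.sqrt (2 * n * Λ)) := by
  rcases Nat.eq_zero_or_pos n with rfl | hn
  · simp
  rcases hr.eq_or_lt with rfl | hr
  · have : ∀ ε k, sel ε k = 0 := fun ε k => abs_nonpos_iff.1 (hV _ (hsel ε) k)
    simp [this]
  have hn' : (0 : ℝ) < n := by exact_mod_cast hn
  set q := Real.sqrt (2 * n * Λ) with hq
  have hq0 : 0 < q := Real.sqrt_pos.2 (by positivity)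
  have hq2 : q ^ 2 = 2 * n * Λ := Real.sq_sqrt (by positivity)
  set l : ℝ := q / (n * r) with hl
  have hl0 : 0 < l := by positivity
  set M : ℝ := Λ + l ^ 2 * (n * r ^ 2) / 2 with hM
  have hpt : ∀ ε : Fin n → Bool, l * ∑ k, boolSign (ε k) * sel ε k ≤
      M - 1 + (∑ v ∈ V, Real.exp (l * ∑ k, boolSign (ε k) * v k)) * Real.exp (-M) := by
    intro ε
    have h1 := Real.add_one_le_exp (l * ∑ k, boolSign (ε k) * sel ε k - M)
    rw [sub_eq_add_neg, Real.exp_add] at h1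
    have h2 : Real.exp (l * ∑ k, boolSign (ε k) * sel ε k) ≤
        ∑ v ∈ V, Real.exp (l * ∑ k, boolSign (ε k) * v k) :=
      Finset.single_le_sum (f := fun v : Fin n → ℝ => Real.exp (l * ∑ k, boolSign (ε k) * v k))
        (fun _ _ => (Real.exp_pos _).le) (hsel ε)
    have h3 := mul_le_mul_of_nonneg_right h2 (Real.exp_pos (-M)).le
    linarith
  have hsum : ∑ ε : Fin n → Bool, ∑ v ∈ V, Real.exp (l * ∑ k, boolSign (ε k) * v k) ≤
      2 ^ n * Real.exp M := by
    rw [Finset.sum_comm]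
    calc _ ≤ ∑ v ∈ V, 2 ^ n * Real.exp (l ^ 2 * (n * r ^ 2) / 2) :=
          Finset.sum_le_sum fun v hv => sum_exp_signed_le l r v (hV v hv)
      _ = V.card * (2 ^ n * Real.exp (l ^ 2 * (n * r ^ 2) / 2)) := by simp
      _ ≤ Real.exp Λ * (2 ^ n * Real.exp (l ^ 2 * (n * r ^ 2) / 2)) := by gcongr
      _ = _ := by rw [hM, Real.exp_add]; ring
  have htot : l * ∑ ε : Fin n → Bool, ∑ k, boolSign (ε k) * sel ε k ≤ 2 ^ n * M := by
    rw [Finset.mul_sum]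
    calc _ ≤ ∑ ε : Fin n → Bool, (M - 1 +
            (∑ v ∈ V, Real.exp (l * ∑ k, boolSign (ε k) * v k)) * Real.exp (-M)) :=
          Finset.sum_le_sum fun ε _ => hpt ε
      _ = 2 ^ n * (M - 1) + (∑ ε : Fin n → Bool,
            ∑ v ∈ V, Real.exp (l * ∑ k, boolSign (ε k) * v k)) * Real.exp (-M) := by
          rw [Finset.sum_add_distrib, ← Finset.sum_mul]
          simp
          ring
      _ ≤ 2 ^ n * (M - 1) + 2 ^ n * Real.exp M * Real.exp (-M) := by gcongr
      _ = 2 ^ n * M := by rw [mul_assoc, ← Real.exp_add]; simp; ring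
  have hMl : M = l * (r * q) := by
    have : Λ = q ^ 2 / (2 * n) := by rw [hq2]; field_simp
    rw [hM, hl, this]
    field_simp
    ring
  rw [hMl] at htot
  refine le_of_mul_le_mul_left (htot.trans (le_of_eq ?_)) hl0
  ring

theorem sum_boolSign_mul_eq_zero {n : ℕ} (c : Fin n → ℝ) :
    ∑ ε : Fin n → Bool, ∑ k, boolSign (ε k) * c k = 0 := by
  have hneg : ∑ ε : Fin n → Bool, ∑ k, boolSign (ε k) * c k =
      ∑ ε : Fin n → Bool, ∑ k, boolSign (!(ε k)) * c k :=
    (Equiv.sum_comp (Equiv.arrowCongr (Equiv.refl (Fin n)) Equiv.boolNot)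
      (fun ε : Fin n → Bool => ∑ k, boolSign (ε k) * c k)).symm
  have hb : ∀ b, boolSign (!b) = -boolSign b := by intro b; cases b <;> simp [boolSign]
  simp only [hb, neg_mul, Finset.sum_neg_distrib] at hneg
  linarith

/-- Dudley's chaining bound over `J` dyadic scales. -/
theorem sum_signed_chaining_le {ι : Type*} {n : ℕ} (F : ι → Fin n → ℝ) (X τ : ℝ) (hX : 1 < X)
    (hτ : 0 ≤ τ) (W : ℕ → Finset (Fin n → ℝ)) (q : ℕ → ι → Fin n → ℝ) (c : Fin n → ℝ)
    (hq0 : ∀ i, q 0 i = c) (hqW : ∀ j i, q j i ∈ W j)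
    (hW : ∀ j, ((W j).card : ℝ) ≤ X ^ (4 ^ j))
    (hF : ∀ j i k, |F i k - q j i k| ≤ τ / 2 ^ j) (J : ℕ) (sel : (Fin n → Bool) → ι) :
    ∑ ε : Fin n → Bool, ∑ k, boolSign (ε k) * F (sel ε) k ≤
      2 ^ n * (J * (5 * τ * Real.sqrt (n * Real.log X)) + n * (τ / 2 ^ J)) := by
  classical
  have hX0 : 0 < X := by linarith
  have hL : 0 < Real.log X := Real.log_pos hX
  have hlevel : ∀ j, ∑ ε : Fin n → Bool, ∑ k, boolSign (ε k) *
      (q (j + 1) (sel ε) k - q j (sel ε) k) ≤ 2 ^ n * (5 * τ * Real.sqrt (n * Real.log X)) := by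
    intro j
    set D := ((W (j + 1) ×ˢ W j).image fun p => p.1 - p.2).filter
      fun v => ∀ k, |v k| ≤ 3 / 2 * τ / 2 ^ j with hD
    have hcard : (D.card : ℝ) ≤ Real.exp (5 * 4 ^ j * Real.log X) := by
      have h1 : D.card ≤ (W (j + 1)).card * (W j).card := by
        rw [← Finset.card_product]
        exact (Finset.card_filter_le _ _).trans Finset.card_image_le
      calc (D.card : ℝ) ≤ (W (j + 1)).card * (W j).card := by exact_mod_cast h1
        _ ≤ X ^ (4 ^ (j + 1)) * X ^ (4 ^ j) := by
            gcongr
            · exact hW _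
            · exact hW _
        _ = Real.exp (5 * 4 ^ j * Real.log X) := by
            rw [← pow_add, ← Real.exp_log hX0, ← Real.exp_nat_mul, Real.log_exp]
            congr 1
            push_cast
            ring
    have := sum_signed_selection_le D (5 * 4 ^ j * Real.log X) (3 / 2 * τ / 2 ^ j) (by positivity)
      (by positivity) hcard (fun v hv => (Finset.mem_filter.1 hv).2)
      (fun ε => q (j + 1) (sel ε) - q j (sel ε)) (fun ε => by
        refine Finset.mem_filter.2 ⟨Finset.mem_image.2
          ⟨(_, _), Finset.mem_product.2 ⟨hqW (j + 1) (sel ε), hqW j (sel ε)⟩, rfl⟩, fun k => ?_⟩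
        have h1 := hF (j + 1) (sel ε) k
        have h2 := hF j (sel ε) k
        have h3 : τ / 2 ^ (j + 1) = 1 / 2 * (τ / 2 ^ j) := by rw [pow_succ]; field_simp
        rw [h3] at h1
        rw [Pi.sub_apply, abs_le, mul_div_assoc]
        rw [abs_le] at h1 h2
        constructor <;> linarith [h1.1, h1.2, h2.1, h2.2])
    refine this.trans (mul_le_mul_of_nonneg_left ?_ (by positivity))
    have hsq : Real.sqrt (2 * n * (5 * 4 ^ j * Real.log X)) ≤
        10 / 3 * 2 ^ j * Real.sqrt (n * Real.log X) := by
      rw [Real.sqrt_le_left (by positivity), mul_pow, Real.sq_sqrt (by positivity), mul_pow,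
        ← pow_mul, mul_comm j 2, pow_mul]
      have : (0:ℝ) ≤ 4 ^ j * (n * Real.log X) := by positivity
      norm_num
      nlinarith
    calc 3 / 2 * τ / 2 ^ j * Real.sqrt (2 * n * (5 * 4 ^ j * Real.log X))
        ≤ 3 / 2 * τ / 2 ^ j * (10 / 3 * 2 ^ j * Real.sqrt (n * Real.log X)) := by gcongr
      _ = _ := by field_simp; ring
  have hq : ∀ J : ℕ, ∑ ε : Fin n → Bool, ∑ k, boolSign (ε k) * q J (sel ε) k ≤
      2 ^ n * (J * (5 * τ * Real.sqrt (n * Real.log X))) := by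
    intro J
    induction J with
    | zero => simp [hq0, sum_boolSign_mul_eq_zero]
    | succ J ih =>
      have h := hlevel J
      simp only [mul_sub, Finset.sum_sub_distrib] at h
      push_cast
      linarith
  have hlast : ∑ ε : Fin n → Bool, ∑ k, boolSign (ε k) * (F (sel ε) k - q J (sel ε) k) ≤
      2 ^ n * (n * (τ / 2 ^ J)) := by
    calc _ ≤ ∑ _ε : Fin n → Bool, ∑ _k : Fin n, τ / 2 ^ J := by
          refine Finset.sum_le_sum fun ε _ => Finset.sum_le_sum fun k _ => ?_
          refine (le_abs_self _).trans ?_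
          rw [abs_mul, abs_boolSign, one_mul]
          exact hF _ _ _
      _ = _ := by simp
  have h := hq J
  simp only [mul_sub, Finset.sum_sub_distrib] at hlast
  linarith

/-- The largest one-sided deviation between the expectation and the empirical mean over a finite
class. -/
noncomputable def maxDeviation {Ω ι : Type*} [MeasurableSpace Ω] [Fintype ι] [Nonempty ι]
    (μ : Measure Ω) (f : ι → Ω → ℝ) {n : ℕ} (s : Fin n → Ω) : ℝ :=
  Finset.univ.sup' Finset.univ_nonempty fun i => ∫ x, f i x ∂μ - (∑ k, f i (s k)) / n

theorem measurable_univ_sup' {Ω ι : Type*} [MeasurableSpace Ω] [Fintype ι] [Nonempty ι]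
    (g : ι → Ω → ℝ) (hg : ∀ i, Measurable (g i)) :
    Measurable fun x => Finset.univ.sup' Finset.univ_nonempty fun i => g i x := by
  have := Finset.measurable_sup' (s := (Finset.univ : Finset ι)) Finset.univ_nonempty
    (f := g) fun i _ => hg i
  convert this using 1
  ext x
  simp [Finset.sup'_apply]

theorem abs_univ_sup'_le {ι : Type*} [Fintype ι] [Nonempty ι] (g : ι → ℝ) (B : ℝ)
    (hg : ∀ i, |g i| ≤ B) : |Finset.univ.sup' Finset.univ_nonempty g| ≤ B := by
  obtain ⟨i, -, hi⟩ := Finset.exists_mem_eq_sup' (Finset.univ_nonempty (α := ι)) g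
  rw [hi]
  exact hg i

theorem sum_div_mem_unitInterval {n : ℕ} (v : Fin n → ℝ) (h0 : ∀ k, 0 ≤ v k) (h1 : ∀ k, v k ≤ 1) :
    0 ≤ (∑ k, v k) / n ∧ (∑ k, v k) / n ≤ 1 := by
  refine ⟨div_nonneg (Finset.sum_nonneg fun k _ => h0 k) (Nat.cast_nonneg _), ?_⟩
  refine div_le_one_of_le₀ ?_ (Nat.cast_nonneg _)
  calc ∑ k, v k ≤ ∑ _k : Fin n, (1 : ℝ) := Finset.sum_le_sum fun k _ => h1 k
    _ = n := by simp

section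

variable {Ω ι : Type*} [MeasurableSpace Ω] [Fintype ι] [Nonempty ι] (μ : Measure Ω) (f : ι → Ω → ℝ)

theorem measurable_maxDeviation (hf : ∀ i, Measurable (f i)) (n : ℕ) :
    Measurable (maxDeviation μ f (n := n)) :=
  measurable_univ_sup' _ fun i => measurable_const.sub
    ((Finset.measurable_sum _ fun k _ => (hf i).comp (measurable_pi_apply k)).div_const _)

theorem maxDeviation_sub_update_le (h0 : ∀ i x, 0 ≤ f i x)
    (h1 : ∀ i x, f i x ≤ 1) {n : ℕ} (s : Fin n → Ω) (k : Fin n) (x : Ω) :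
    maxDeviation μ f s - maxDeviation μ f (Function.update s k x) ≤ 1 / n := by
  rw [sub_le_iff_le_add]
  refine Finset.sup'_le _ _ fun i _ => ?_
  have hle := Finset.le_sup' (s := Finset.univ)
    (fun i => ∫ x, f i x ∂μ - (∑ j, f i (Function.update s k x j)) / n) (Finset.mem_univ i)
  have hs : ∑ j, f i (Function.update s k x j) - ∑ j, f i (s j) = f i x - f i (s k) := by
    rw [← Finset.sum_sub_distrib, Finset.sum_eq_single k]
    · simp
    · intro j _ hj
      simp [hj]
    · simp
  have hd : (∑ j, f i (Function.update s k x j)) / n - (∑ j, f i (s j)) / n ≤ 1 / n := by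
    rw [← sub_div, hs]
    gcongr
    linarith [h0 i (s k), h1 i x]
  unfold maxDeviation
  linarith

variable [IsProbabilityMeasure μ]

theorem integral_mem_unitInterval (g : Ω → ℝ) (hg : Measurable g) (h0 : ∀ x, 0 ≤ g x)
    (h1 : ∀ x, g x ≤ 1) : 0 ≤ ∫ x, g x ∂μ ∧ ∫ x, g x ∂μ ≤ 1 := by
  refine ⟨integral_nonneg h0, ?_⟩
  calc ∫ x, g x ∂μ ≤ ∫ _, (1 : ℝ) ∂μ :=
        integral_mono (integrable_of_abs_le hg 1 fun x => abs_le.2 ⟨by linarith [h0 x], h1 x⟩)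
          (integrable_const _) h1
    _ = 1 := by simp

theorem abs_maxDeviation_le (hf : ∀ i, Measurable (f i)) (h0 : ∀ i x, 0 ≤ f i x)
    (h1 : ∀ i x, f i x ≤ 1) {n : ℕ} (s : Fin n → Ω) : |maxDeviation μ f s| ≤ 1 := by
  refine abs_univ_sup'_le _ _ fun i => ?_
  have h2 := integral_mem_unitInterval μ (f i) (hf i) (h0 i) (h1 i)
  have h3 := sum_div_mem_unitInterval (fun k => f i (s k)) (fun k => h0 i _) (fun k => h1 i _)
  rw [abs_le]
  constructor <;> linarith [h2.1, h2.2, h3.1, h3.2]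

/-- Symmetrisation: the expected maximal deviation is controlled by sign averages of the
differences between a sample and a ghost sample. -/
theorem integral_maxDeviation_le (hf : ∀ i, Measurable (f i)) (h0 : ∀ i x, 0 ≤ f i x)
    (h1 : ∀ i x, f i x ≤ 1) (G : Set Ω) (hG : ∀ᵐ x ∂μ, x ∈ G) (n : ℕ) (hn : 0 < n) (B : ℝ)
    (hB : ∀ x x' : Fin n → Ω, (∀ k, x k ∈ G) → (∀ k, x' k ∈ G) → ∀ sel : (Fin n → Bool) → ι,
      ∑ ε : Fin n → Bool, ∑ k, boolSign (ε k) * (f (sel ε) (x' k) - f (sel ε) (x k)) ≤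
        2 ^ n * (n * B)) :
    ∫ s : Fin n → Ω, maxDeviation μ f s ∂(Measure.pi fun _ => μ) ≤ B := by
  have hn' : (0 : ℝ) < n := by exact_mod_cast hn
  set π : Measure (Fin n → Ω) := Measure.pi fun _ => μ with hπ
  set ν : Measure (Fin n → Ω × Ω) := Measure.pi fun _ => μ.prod μ with hν
  set Ψ : (Fin n → Bool) → (Fin n → Ω × Ω) → ℝ := fun ε p =>
    Finset.univ.sup' Finset.univ_nonempty fun i =>
      (∑ k, boolSign (ε k) * (f i (p k).2 - f i (p k).1)) / n with hΨ
  have hΨm : ∀ ε, Measurable (Ψ ε) := fun ε => measurable_univ_sup' _ fun i => by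
    refine (Finset.measurable_sum _ fun k _ => ?_).div_const _
    refine Measurable.const_mul ?_ _
    exact ((hf i).comp (measurable_snd.comp (measurable_pi_apply k))).sub
      ((hf i).comp (measurable_fst.comp (measurable_pi_apply k)))
  have hΨb : ∀ ε p, |Ψ ε p| ≤ 1 := fun ε p => abs_univ_sup'_le _ _ fun i => by
    rw [abs_div, Nat.abs_cast]
    refine div_le_one_of_le₀ ?_ hn'.le
    calc |∑ k, boolSign (ε k) * (f i (p k).2 - f i (p k).1)|
        ≤ ∑ k, |boolSign (ε k) * (f i (p k).2 - f i (p k).1)| := Finset.abs_sum_le_sum_abs _ _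
      _ ≤ ∑ _k : Fin n, (1 : ℝ) := by
          refine Finset.sum_le_sum fun k _ => ?_
          rw [abs_mul, abs_boolSign, one_mul, abs_le]
          constructor <;> linarith [h0 i (p k).1, h0 i (p k).2, h1 i (p k).1, h1 i (p k).2]
      _ = n := by simp
  have hΨi : ∀ ε, Integrable (Ψ ε) ν := fun ε => integrable_of_abs_le (hΨm ε) 1 (hΨb ε)
  have hswap : ∀ ε, ∫ p, Ψ ε p ∂ν = ∫ p, Ψ (fun _ => true) p ∂ν := by
    intro ε
    let φ : Fin n → (Ω × Ω ≃ᵐ Ω × Ω) := fun k =>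
      if ε k then MeasurableEquiv.refl _ else MeasurableEquiv.prodComm
    have hφ : ∀ k, MeasurePreserving (φ k) (μ.prod μ) (μ.prod μ) := by
      intro k
      by_cases h : ε k
      · have hk : φ k = MeasurableEquiv.refl _ := by simp [φ, h]
        rw [hk]
        exact MeasurePreserving.id (μ.prod μ)
      · have hk : φ k = MeasurableEquiv.prodComm := by simp [φ, h]
        rw [hk]
        exact Measure.measurePreserving_swap (μ := μ) (ν := μ)
    have hmp : MeasurePreserving (fun (p : Fin n → Ω × Ω) k => φ k (p k)) ν ν :=
      measurePreserving_pi _ _ hφ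
    rw [← hmp.map_eq, integral_map hmp.measurable.aemeasurable
      (hΨm _).aestronglyMeasurable, hmp.map_eq]
    refine integral_congr_ae (Filter.Eventually.of_forall fun p => ?_)
    simp only [hΨ]
    refine Finset.sup'_congr _ rfl fun i _ => ?_
    congr 1
    refine Finset.sum_congr rfl fun k _ => ?_
    by_cases h : ε k <;> simp [φ, h, boolSign, MeasurableEquiv.prodComm]
  have hghost : ∫ s, maxDeviation μ f s ∂π ≤ ∫ p, Ψ (fun _ => true) p ∂ν := by
    have hmp := (measurePreserving_arrowProdEquivProdArrow Ω Ω (Fin n) (fun _ => μ)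
      (fun _ => μ)).symm
    rw [← hmp.integral_comp' (g := Ψ fun _ => true)]
    have hm : Measurable fun q => Ψ (fun _ => true)
        ((MeasurableEquiv.arrowProdEquivProdArrow Ω Ω (Fin n)).symm q) :=
      (hΨm _).comp (MeasurableEquiv.measurable _)
    have hi : Integrable (fun q => Ψ (fun _ => true)
        ((MeasurableEquiv.arrowProdEquivProdArrow Ω Ω (Fin n)).symm q)) (π.prod π) :=
      integrable_of_abs_le hm 1 fun q => hΨb _ _
    refine le_trans ?_ (integral_prod _ hi).ge
    refine integral_mono (integrable_of_abs_le (measurable_maxDeviation μ f hf n) 1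
      (abs_maxDeviation_le μ f hf h0 h1)) hi.integral_prod_left fun s => ?_
    refine Finset.sup'_le _ _ fun i _ => ?_
    have hcoord : ∀ k : Fin n, Integrable (fun s' : Fin n → Ω => f i (s' k)) π := fun k =>
      integrable_of_abs_le ((hf i).comp (measurable_pi_apply k)) 1 fun x =>
        abs_le.2 ⟨by linarith [h0 i (x k)], h1 i (x k)⟩
    have hmean : ∀ k : Fin n, ∫ s' : Fin n → Ω, f i (s' k) ∂π = ∫ x, f i x ∂μ := fun k => by
      have := measurePreserving_eval (fun _ : Fin n => μ) k
      rw [← this.map_eq, integral_map this.measurable.aemeasurable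
        (hf i).aestronglyMeasurable]
    have heq : ∫ x, f i x ∂μ - (∑ k, f i (s k)) / n =
        ∫ s' : Fin n → Ω, (∑ k, (f i (s' k) - f i (s k))) / n ∂π := by
      have hk : ∀ k, ∫ s' : Fin n → Ω, (f i (s' k) - f i (s k)) ∂π =
          ∫ x, f i x ∂μ - f i (s k) := fun k => by
        rw [integral_sub (hcoord k) (integrable_const _), hmean]
        simp
      rw [integral_div, integral_finsetSum (f := fun k (s' : Fin n → Ω) => f i (s' k) - f i (s k)) _
        fun k _ => (hcoord k).sub (integrable_const _)]
      simp_rw [hk]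
      rw [Finset.sum_sub_distrib, sub_div]
      simp
      field_simp
    rw [heq]
    refine integral_mono ?_ ?_ fun s' => ?_
    · exact (integrable_finsetSum _ fun k _ => (hcoord k).sub (integrable_const _)).div_const _
    · exact integrable_of_abs_le (hm.comp measurable_prodMk_left) 1 fun q => hΨb _ _
    · refine le_trans (le_of_eq ?_) (Finset.le_sup' (s := Finset.univ) _ (Finset.mem_univ i))
      simp [boolSign, MeasurableEquiv.arrowProdEquivProdArrow]
  have hae : ∀ᵐ p ∂ν, ∀ k, (p k).1 ∈ G ∧ (p k).2 ∈ G := by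
    refine Filter.eventually_all.2 fun k => ?_
    have h1' : ∀ᵐ q ∂(μ.prod μ), q.1 ∈ G := Measure.quasiMeasurePreserving_fst.ae hG
    have h2' : ∀ᵐ q ∂(μ.prod μ), q.2 ∈ G := Measure.quasiMeasurePreserving_snd.ae hG
    exact (Measure.tendsto_eval_ae_ae (μ := fun _ : Fin n => μ.prod μ) (i := k)).eventually
      (h1'.and h2')
  have hbound : ∫ p, ∑ ε : Fin n → Bool, Ψ ε p ∂ν ≤ 2 ^ n * B := by
    calc ∫ p, ∑ ε : Fin n → Bool, Ψ ε p ∂ν ≤ ∫ _, 2 ^ n * B ∂ν := by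
          refine integral_mono_ae (integrable_finsetSum _ fun ε _ => hΨi ε)
            (integrable_const _) ?_
          filter_upwards [hae] with p hp
          have hch : ∀ ε, ∃ i, Ψ ε p =
              (∑ k, boolSign (ε k) * (f i (p k).2 - f i (p k).1)) / n := fun ε => by
            obtain ⟨i, -, hi⟩ := Finset.exists_mem_eq_sup' (Finset.univ_nonempty (α := ι))
              fun i => (∑ k, boolSign (ε k) * (f i (p k).2 - f i (p k).1)) / n
            exact ⟨i, hi⟩
          choose sel hsel using hch
          simp_rw [hsel]
          rw [← Finset.sum_div, div_le_iff₀ hn']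
          exact (hB (fun k => (p k).1) (fun k => (p k).2) (fun k => (hp k).1)
            (fun k => (hp k).2) sel).trans (le_of_eq (by ring))
      _ = 2 ^ n * B := by simp
  rw [integral_finsetSum _ fun ε _ => hΨi ε] at hbound
  simp_rw [hswap] at hbound
  simp only [Finset.sum_const, Finset.card_univ, Fintype.card_pi, Fintype.card_bool,
    Finset.prod_const, Fintype.card_fin, nsmul_eq_mul, Nat.cast_pow, Nat.cast_ofNat] at hbound
  exact hghost.trans (le_of_mul_le_mul_left hbound (by positivity))

end

/-- Sup-norm covers at every scale: the family `f` lies within `ρ` of one point, and for every `K`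
it has a cover of at most `X ^ K` points at scale `ρ / √K`. -/
def HasCovers {ι κ : Type*} (f : ι → κ → ℝ) (X ρ : ℝ) : Prop :=
  (∃ c : κ → ℝ, ∀ i k, |f i k - c k| ≤ ρ) ∧
    ∀ K : ℕ, 0 < K → ∃ V : Finset (κ → ℝ), (V.card : ℝ) ≤ X ^ K ∧
      ∀ i, ∃ v ∈ V, ∀ k, |f i k - v k| ≤ ρ / Real.sqrt K

theorem sum_signed_le_of_hasCovers {ι : Type*} {n : ℕ} (f : ι → Fin n ⊕ Fin n → ℝ) (X ρ : ℝ)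
    (hX : 1 < X) (hρ : 0 ≤ ρ) (hcov : HasCovers f X ρ) (J : ℕ) (sel : (Fin n → Bool) → ι) :
    ∑ ε : Fin n → Bool, ∑ k, boolSign (ε k) * (f (sel ε) (Sum.inr k) - f (sel ε) (Sum.inl k)) ≤
      2 ^ n * (J * (10 * ρ * Real.sqrt (n * Real.log X)) + n * (2 * ρ / 2 ^ J)) := by
  classical
  obtain ⟨⟨c, hc⟩, hV⟩ := hcov
  choose V hVc hVf using fun j : ℕ => hV (4 ^ j) (by positivity)
  choose v hvm hv using hVf
  let T : (Fin n ⊕ Fin n → ℝ) → Fin n → ℝ := fun u k => u (Sum.inr k) - u (Sum.inl k)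
  have hT : ∀ (u u' : Fin n ⊕ Fin n → ℝ) (r : ℝ), (∀ k, |u k - u' k| ≤ r) →
      ∀ k, |T u k - T u' k| ≤ 2 * r := fun u u' r h k => by
    have h1 := abs_le.1 (h (Sum.inr k))
    have h2 := abs_le.1 (h (Sum.inl k))
    simp only [T]
    rw [abs_le]
    constructor <;> linarith [h1.1, h1.2, h2.1, h2.2]
  have := sum_signed_chaining_le (fun i => T (f i)) X (2 * ρ) hX (by positivity)
    (fun j => Nat.casesOn j {T c} fun j => (V (j + 1)).image T)
    (fun j i => Nat.casesOn j (T c) fun j => T (v (j + 1) i)) (T c) (fun i => rfl)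
    (fun j i => by
      cases j with
      | zero => exact Finset.mem_singleton_self _
      | succ j => exact Finset.mem_image_of_mem _ (hvm _ _))
    (fun j => by
      cases j with
      | zero => simpa using hX.le
      | succ j =>
        refine le_trans ?_ (hVc (j + 1))
        exact_mod_cast Finset.card_image_le)
    (fun j i k => by
      cases j with
      | zero => simpa using hT _ _ _ (hc i) k
      | succ j =>
        refine (hT _ _ _ (hv (j + 1) i) k).trans (le_of_eq ?_)
        have : Real.sqrt ((4 ^ (j + 1) : ℕ) : ℝ) = 2 ^ (j + 1) := by
          rw [Real.sqrt_eq_iff_mul_self_eq (by positivity) (by positivity)]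
          push_cast
          rw [← mul_pow]
          norm_num
        rw [this, mul_div_assoc]) J sel
  refine this.trans (le_of_eq ?_)
  ring

/-- Uniform one-sided deviation inequality for a finite class whose restrictions to all
double samples have sup-norm covers. -/
theorem measure_exists_deviation_le {Ω ι : Type*} [MeasurableSpace Ω] [Finite ι]
    (μ : Measure Ω) [IsProbabilityMeasure μ] (f : ι → Ω → ℝ) (hf : ∀ i, Measurable (f i))
    (h0 : ∀ i x, 0 ≤ f i x) (h1 : ∀ i x, f i x ≤ 1) (G : Set Ω) (hG : ∀ᵐ x ∂μ, x ∈ G)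
    (n : ℕ) (hn : 0 < n) (X ρ : ℝ) (hX : 1 < X) (hρ : 0 ≤ ρ)
    (hcov : ∀ z : Fin n ⊕ Fin n → Ω, (∀ k, z k ∈ G) → HasCovers (fun i k => f i (z k)) X ρ)
    (J : ℕ) (t : ℝ) (ht : 0 ≤ t) :
    (Measure.pi fun _ : Fin n => μ) {s | ∃ i, (∑ k, f i (s k)) / n +
        (J * (10 * ρ * Real.sqrt (Real.log X / n)) + 2 * ρ / 2 ^ J) + t ≤ ∫ x, f i x ∂μ} ≤
      ENNReal.ofReal (Real.exp (-(2 * n * t ^ 2))) := by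
  have := Fintype.ofFinite ι
  rcases isEmpty_or_nonempty ι with hι | hι
  · simp
  have hn' : (0 : ℝ) < n := by exact_mod_cast hn
  have hmean := integral_maxDeviation_le μ f hf h0 h1 G hG n hn
    (J * (10 * ρ * Real.sqrt (Real.log X / n)) + 2 * ρ / 2 ^ J) (fun x x' hx hx' sel => by
      have hz : ∀ k : Fin n ⊕ Fin n, Sum.elim x x' k ∈ G := by
        rintro (k | k)
        · exact hx k
        · exact hx' k
      refine (sum_signed_le_of_hasCovers _ X ρ hX hρ (hcov _ hz) J sel).trans (le_of_eq ?_)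
      have hsq : Real.sqrt (n * Real.log X) = n * Real.sqrt (Real.log X / n) := by
        rw [show (n : ℝ) * Real.log X = n ^ 2 * (Real.log X / n) by field_simp,
          Real.sqrt_mul (by positivity), Real.sqrt_sq hn'.le]
      rw [hsq]
      ring)
  have hmc := measure_ge_le_of_bounded_differences μ 1 n hn (maxDeviation μ f)
    (measurable_maxDeviation μ f hf n) (abs_maxDeviation_le μ f hf h0 h1)
    (maxDeviation_sub_update_le μ f h0 h1) t ht
  refine le_trans (measure_mono ?_) (ENNReal.le_ofReal_iff_toReal_le (measure_ne_top _ _)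
    (Real.exp_pos _).le |>.2 hmc)
  rintro s ⟨i, hi⟩
  have hle := Finset.le_sup' (s := Finset.univ)
    (fun i => ∫ x, f i x ∂μ - (∑ k, f i (s k)) / n) (Finset.mem_univ i)
  simp only [Set.mem_ofPred_eq]
  unfold maxDeviation at hmean ⊢
  linarith

section Perceptron

variable {ι κ : Type*} [Fintype ι] [Fintype κ]

theorem l2_sq (v : κ → ℝ) : l2 v ^ 2 = v ⬝ᵥ v := by
  rw [l2, Real.sq_sqrt (Finset.sum_nonneg fun i _ => sq_nonneg _)]
  simp [dotProduct, sq]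

theorem l2_nonneg (v : κ → ℝ) : 0 ≤ l2 v := Real.sqrt_nonneg _

theorem abs_dotProduct_le (v u : κ → ℝ) : |v ⬝ᵥ u| ≤ l2 v * l2 u := by
  refine abs_le_of_sq_le_sq ?_ (mul_nonneg (l2_nonneg _) (l2_nonneg _))
  rw [mul_pow, l2, l2, Real.sq_sqrt (Finset.sum_nonneg fun i _ => sq_nonneg _),
    Real.sq_sqrt (Finset.sum_nonneg fun i _ => sq_nonneg _)]
  exact Finset.sum_mul_sq_le_sq_mul_sq _ _ _

open Classical in
/-- The vectors reachable from `0` by at most `k` steps of the form `±η u i`. -/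
noncomputable def stepCover (u : ι → κ → ℝ) (η : ℝ) : ℕ → Finset (κ → ℝ)
  | 0 => {0}
  | k + 1 => (stepCover u η k ×ˢ (Finset.univ : Finset (Option (ι × Bool)))).image fun p =>
      p.1 + p.2.elim 0 fun q => (η * boolSign q.2) • u q.1

theorem card_stepCover_le (u : ι → κ → ℝ) (η : ℝ) (k : ℕ) :
    (stepCover u η k).card ≤ (2 * Fintype.card ι + 1) ^ k := by
  induction k with
  | zero => simp [stepCover]
  | succ k ih =>
    rw [stepCover]
    refine Finset.card_image_le.trans ?_
    rw [Finset.card_product, pow_succ]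
    refine Nat.mul_le_mul ih ?_
    simp [mul_comm]

theorem stepCover_none {u : ι → κ → ℝ} {η : ℝ} {k : ℕ} {v : κ → ℝ} (hv : v ∈ stepCover u η k) :
    v ∈ stepCover u η (k + 1) := by
  rw [stepCover]
  exact Finset.mem_image.2 ⟨(v, none), by simp [hv], by simp⟩

theorem stepCover_some {u : ι → κ → ℝ} {η : ℝ} {k : ℕ} {v : κ → ℝ} (hv : v ∈ stepCover u η k)
    (i : ι) (b : Bool) : v + (η * boolSign b) • u i ∈ stepCover u η (k + 1) := by
  rw [stepCover]
  exact Finset.mem_image.2 ⟨(v, some (i, b)), by simp [hv], by simp⟩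

/-- The perceptron argument: `k` corrections of size `a / (b √k)` bring the predictions of any
vector of norm at most `a` within `a b / √k`. -/
theorem exists_mem_stepCover (u : ι → κ → ℝ) (a b : ℝ) (ha : 0 < a) (hb : 0 < b)
    (hu : ∀ i, l2 (u i) ≤ b) (K : ℕ) (hK : 0 < K) (v : κ → ℝ) (hv : l2 v ≤ a) :
    ∃ v' ∈ stepCover u (a / (b * Real.sqrt K)) K,
      ∀ i, |(v - v') ⬝ᵥ u i| ≤ a * b / Real.sqrt K := by
  have hK' : (0 : ℝ) < K := by exact_mod_cast hK
  set s := Real.sqrt K with hs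
  have hs0 : 0 < s := Real.sqrt_pos.2 hK'
  have hs2 : s ^ 2 = K := Real.sq_sqrt hK'.le
  set η := a / (b * s) with hη
  have hη0 : 0 < η := by positivity
  have key : ∀ k : ℕ, ∃ v' ∈ stepCover u η k, (∀ i, |(v - v') ⬝ᵥ u i| ≤ a * b / s) ∨
      (v - v') ⬝ᵥ (v - v') ≤ a ^ 2 - k * (a ^ 2 / K) := by
    intro k
    induction k with
    | zero =>
      refine ⟨0, by simp [stepCover], Or.inr ?_⟩
      rw [sub_zero, ← l2_sq]
      have := pow_le_pow_left₀ (l2_nonneg v) hv 2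
      simpa using this
    | succ k ih =>
      obtain ⟨v', hv', h | h⟩ := ih
      · exact ⟨v', stepCover_none hv', Or.inl h⟩
      by_cases hall : ∀ i, |(v - v') ⬝ᵥ u i| ≤ a * b / s
      · exact ⟨v', stepCover_none hv', Or.inl hall⟩
      push Not at hall
      obtain ⟨i, hi⟩ := hall
      have hui : u i ⬝ᵥ u i ≤ b ^ 2 := by
        rw [← l2_sq]
        exact pow_le_pow_left₀ (l2_nonneg _) (hu i) 2
      obtain ⟨β, hβ⟩ : ∃ β : Bool, boolSign β * ((v - v') ⬝ᵥ u i) = |(v - v') ⬝ᵥ u i| := by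
        rcases le_total 0 ((v - v') ⬝ᵥ u i) with h0 | h0
        · exact ⟨true, by rw [abs_of_nonneg h0, boolSign, if_pos rfl, one_mul]⟩
        · exact ⟨false, by rw [abs_of_nonpos h0, boolSign, if_neg (by simp), neg_one_mul]⟩
      have hβ2 : boolSign β ^ 2 = 1 := by cases β <;> simp [boolSign]
      refine ⟨_, stepCover_some hv' i β, Or.inr ?_⟩
      have hexp : (v - (v' + (η * boolSign β) • u i)) ⬝ᵥ (v - (v' + (η * boolSign β) • u i)) =
          (v - v') ⬝ᵥ (v - v') - 2 * η * (boolSign β * ((v - v') ⬝ᵥ u i)) +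
            η ^ 2 * boolSign β ^ 2 * (u i ⬝ᵥ u i) := by
        rw [← sub_sub]
        generalize v - v' = r
        simp only [sub_dotProduct, dotProduct_sub, smul_dotProduct, dotProduct_smul, smul_eq_mul]
        rw [dotProduct_comm (u i) r]
        ring
      rw [hexp, hβ, hβ2, mul_one]
      have h1 : 2 * η * (a * b / s) ≤ 2 * η * |(v - v') ⬝ᵥ u i| := by gcongr
      have h2 : η ^ 2 * (u i ⬝ᵥ u i) ≤ η ^ 2 * b ^ 2 := by gcongr
      have h3 : 2 * η * (a * b / s) = 2 * (a ^ 2 / K) := by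
        rw [hη, ← hs2]; field_simp
      have h4 : η ^ 2 * b ^ 2 = a ^ 2 / K := by
        rw [hη, ← hs2]; field_simp
      push_cast
      linarith
  obtain ⟨v', hv', h | h⟩ := key K
  · exact ⟨v', hv', h⟩
  · refine ⟨v', hv', fun i => ?_⟩
    have h0 : (v - v') ⬝ᵥ (v - v') ≤ 0 := h.trans (le_of_eq (by field_simp; ring))
    rw [← l2_sq] at h0
    have hz : l2 (v - v') = 0 := by
      have := sq_nonneg (l2 (v - v'))
      exact pow_eq_zero_iff (two_ne_zero) |>.1 (le_antisymm h0 this)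
    refine (abs_dotProduct_le _ _).trans ?_
    rw [hz, zero_mul]
    positivity

open Classical in
/-- Ways to distribute at most `K` unit steps among `m` rows. -/
noncomputable def allocations (m : ℕ) : ℕ → Finset (Fin m → ℕ)
  | 0 => {0}
  | K + 1 => (allocations m K ×ˢ (Finset.univ : Finset (Option (Fin m)))).image fun p =>
      p.1 + p.2.elim 0 fun f => Pi.single f 1

theorem card_allocations_le (m K : ℕ) : (allocations m K).card ≤ (m + 1) ^ K := by
  induction K with
  | zero => simp [allocations]
  | succ K ih =>
    rw [allocations]
    refine Finset.card_image_le.trans ?_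
    rw [Finset.card_product, pow_succ]
    exact Nat.mul_le_mul ih (by simp)

theorem mem_allocations {m : ℕ} (K : ℕ) (k : Fin m → ℕ) (hk : ∑ f, k f ≤ K) :
    k ∈ allocations m K := by
  induction K generalizing k with
  | zero =>
    have : k = 0 := by
      funext f
      exact Nat.le_zero.1 ((Finset.single_le_sum (fun _ _ => Nat.zero_le _)
        (Finset.mem_univ f)).trans hk)
    simp [allocations, this]
  | succ K ih =>
    rw [allocations]
    by_cases h : ∑ f, k f ≤ K
    · exact Finset.mem_image.2 ⟨(k, none), by simp [ih k h], by simp⟩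
    obtain ⟨f, -, hf⟩ : ∃ f ∈ Finset.univ, k f ≠ 0 := by
      by_contra! h0
      exact h (by rw [Finset.sum_eq_zero h0]; exact Nat.zero_le _)
    have hle : Pi.single f 1 ≤ k := by
      intro g
      rcases eq_or_ne g f with rfl | hg
      · simpa using Nat.one_le_iff_ne_zero.2 hf
      · simp [hg]
    have hadd : (k - Pi.single f 1) + Pi.single f 1 = k := tsub_add_cancel_of_le hle
    refine Finset.mem_image.2 ⟨(k - Pi.single f 1, some f), ?_, by simpa using hadd⟩
    refine Finset.mem_product.2 ⟨ih _ ?_, Finset.mem_univ _⟩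
    have hs : ∑ g, (k - Pi.single f 1 : Fin m → ℕ) g + 1 = ∑ g, k g := by
      conv_rhs => rw [← hadd]
      simp [Finset.sum_add_distrib]
    dsimp only
    omega

/-- Covers of the `(2,1)`-ball: errors are measured by the `ℓ²` norm over the rows of the largest
prediction error of each row. -/
theorem exists_rowwise_cover (m : ℕ) (u : ι → κ → ℝ) (a b : ℝ) (ha : 0 < a) (hb : 0 < b)
    (hu : ∀ i, l2 (u i) ≤ b) (K : ℕ) (hK : 0 < K) :
    ∃ V : Finset (Fin m → κ → ℝ),
      V.card ≤ ((m + 1) * (2 * Fintype.card ι + 1)) ^ K ∧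
      ∀ A : Fin m → κ → ℝ, ∑ f, l2 (A f) ≤ a → ∃ A' ∈ V, ∃ e : Fin m → ℝ,
        (∀ f i, |(A f - A' f) ⬝ᵥ u i| ≤ e f) ∧ (∀ f, 0 ≤ e f) ∧
          l2 e ≤ 2 * a * b / Real.sqrt K := by
  classical
  have hK' : (0 : ℝ) < K := by exact_mod_cast hK
  let η : ℕ → ℝ := fun k => ((k + 1) * a / K) / (b * Real.sqrt k)
  let V : Finset (Fin m → κ → ℝ) := ((allocations m K).filter fun k => ∑ f, k f ≤ K).biUnion
    fun k => Fintype.piFinset fun f => stepCover u (η (k f)) (k f)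
  refine ⟨V, ?_, fun A hA => ?_⟩
  · rw [mul_pow]
    refine (Finset.card_biUnion_le_card_mul _ _ ((2 * Fintype.card ι + 1) ^ K) ?_).trans
      (Nat.mul_le_mul_right _ ((Finset.card_filter_le _ _).trans (card_allocations_le m K)))
    intro k hk
    rw [Fintype.card_piFinset]
    calc ∏ f, (stepCover u (η (k f)) (k f)).card
        ≤ ∏ f, (2 * Fintype.card ι + 1) ^ (k f) :=
          Finset.prod_le_prod' fun f _ => card_stepCover_le _ _ _
      _ = (2 * Fintype.card ι + 1) ^ (∑ f, k f) := Finset.prod_pow_eq_pow_sum _ _ _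
      _ ≤ _ := Nat.pow_le_pow_right (by omega) (Finset.mem_filter.1 hk).2
  · let k : Fin m → ℕ := fun f => ⌊K * l2 (A f) / a⌋₊
    have hkle : ∀ f, (k f : ℝ) ≤ K * l2 (A f) / a := fun f =>
      Nat.floor_le (div_nonneg (mul_nonneg hK'.le (l2_nonneg _)) ha.le)
    have hklt : ∀ f, K * l2 (A f) / a < k f + 1 := fun f => Nat.lt_floor_add_one _
    have hksum : ∑ f, k f ≤ K := by
      have : ((∑ f, k f : ℕ) : ℝ) ≤ K := by
        push_cast
        calc ∑ f, (k f : ℝ) ≤ ∑ f, K * l2 (A f) / a := Finset.sum_le_sum fun f _ => hkle f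
          _ = K * (∑ f, l2 (A f)) / a := by rw [Finset.mul_sum, Finset.sum_div]
          _ ≤ K * a / a := by gcongr
          _ = K := by field_simp
      exact_mod_cast this
    have hrad : ∀ f, l2 (A f) ≤ (k f + 1) * a / K := fun f => by
      have := hklt f
      rw [div_lt_iff₀ ha] at this
      rw [le_div_iff₀ hK']
      linarith
    have hrow : ∀ f, ∃ v' ∈ stepCover u (η (k f)) (k f), ∃ e : ℝ, 0 ≤ e ∧
        (∀ i, |(A f - v') ⬝ᵥ u i| ≤ e) ∧ e ^ 2 ≤ 4 * l2 (A f) * a * b ^ 2 / K := by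
      intro f
      rcases Nat.eq_zero_or_pos (k f) with h0 | hpos
      · refine ⟨0, by rw [h0]; simp [stepCover], l2 (A f) * b,
          mul_nonneg (l2_nonneg _) hb.le, fun i => ?_, ?_⟩
        · rw [sub_zero]
          exact (abs_dotProduct_le _ _).trans
            (mul_le_mul_of_nonneg_left (hu i) (l2_nonneg _))
        · have h := hrad f
          rw [h0] at h
          have h' := mul_le_mul_of_nonneg_left h (l2_nonneg (A f))
          have h'' := mul_le_mul_of_nonneg_right h' (sq_nonneg b)
          have hn : 0 ≤ l2 (A f) * a * b ^ 2 / K := by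
            have := l2_nonneg (A f)
            positivity
          calc (l2 (A f) * b) ^ 2 = l2 (A f) * l2 (A f) * b ^ 2 := by ring
            _ ≤ l2 (A f) * a * b ^ 2 / K := h''.trans (le_of_eq (by push_cast; ring))
            _ ≤ 4 * (l2 (A f) * a * b ^ 2 / K) := by linarith
            _ = _ := by ring
      · have hk' : (1 : ℝ) ≤ k f := by exact_mod_cast hpos
        obtain ⟨v', hv', hv⟩ := exists_mem_stepCover u ((k f + 1) * a / K) b (by positivity) hb hu
          (k f) hpos (A f) (hrad f)
        refine ⟨v', hv', _, by positivity, hv, ?_⟩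
        rw [div_pow, Real.sq_sqrt (by positivity), div_le_iff₀ (by positivity)]
        have h1 : ((k f : ℝ) + 1) ^ 2 ≤ 4 * (k f) ^ 2 := by nlinarith
        calc ((k f + 1) * a / K * b) ^ 2 = (k f + 1 : ℝ) ^ 2 * (a ^ 2 * b ^ 2 / K ^ 2) := by ring
          _ ≤ 4 * (k f) ^ 2 * (a ^ 2 * b ^ 2 / K ^ 2) := by gcongr
          _ = 4 * (a ^ 2 * b ^ 2 / K ^ 2) * k f * k f := by ring
          _ ≤ 4 * (a ^ 2 * b ^ 2 / K ^ 2) * (K * l2 (A f) / a) * k f := by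
              gcongr
              exact hkle f
          _ = _ := by field_simp
    choose A' hA' e he0 he hesq using hrow
    refine ⟨A', ?_, e, he, he0, ?_⟩
    · exact Finset.mem_biUnion.2 ⟨k, Finset.mem_filter.2 ⟨mem_allocations K k hksum, hksum⟩,
        Fintype.mem_piFinset.2 hA'⟩
    · rw [l2, Real.sqrt_le_left (by positivity), div_pow, Real.sq_sqrt hK'.le]
      calc ∑ f, e f ^ 2 ≤ ∑ f, 4 * l2 (A f) * a * b ^ 2 / K := Finset.sum_le_sum fun f _ => hesq f
        _ = 4 * (∑ f, l2 (A f)) * a * b ^ 2 / K := by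
            rw [Finset.mul_sum, Finset.sum_mul, Finset.sum_mul, Finset.sum_div]
        _ ≤ 4 * a * a * b ^ 2 / K := by gcongr
        _ = _ := by ring

/-- Covers of the Frobenius ball of `C`-row matrices in the sup norm over rows and data. -/
theorem exists_frobenius_cover (C : ℕ) (h : ι → κ → ℝ) (a b : ℝ) (ha : 0 < a) (hb : 0 < b)
    (hh : ∀ i, l2 (h i) ≤ b) (K : ℕ) (hK : 0 < K) :
    ∃ V : Finset (Fin C → κ → ℝ), V.card ≤ (2 * (C * Fintype.card ι) + 1) ^ K ∧
      ∀ A : Fin C → κ → ℝ, frob A ≤ a → ∃ A' ∈ V, ∀ c i,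
        |(A c - A' c) ⬝ᵥ h i| ≤ a * b / Real.sqrt K := by
  classical
  let u : Fin C × ι → Fin C × κ → ℝ := fun p q => if q.1 = p.1 then h p.2 q.2 else 0
  have hdot : ∀ (v : Fin C × κ → ℝ) p, v ⬝ᵥ u p = (fun q => v (p.1, q)) ⬝ᵥ h p.2 := fun v p => by
    simp only [dotProduct, u, mul_ite, mul_zero]
    rw [Fintype.sum_prod_type, Finset.sum_eq_single p.1]
    · simp
    · intro c _ hc
      simp [hc]
    · simp
  have hu : ∀ p, l2 (u p) ≤ b := fun p => by
    have : l2 (u p) ^ 2 = l2 (h p.2) ^ 2 := by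
      rw [l2_sq, l2_sq, hdot]
      simp [u]
    rw [pow_left_inj₀ (l2_nonneg _) (l2_nonneg _) two_ne_zero] at this
    rw [this]
    exact hh _
  refine ⟨(stepCover u (a / (b * Real.sqrt K)) K).image fun v c q => v (c, q), ?_, ?_⟩
  · refine Finset.card_image_le.trans ((card_stepCover_le _ _ _).trans (le_of_eq ?_))
    simp
  · intro A hA
    have hl : l2 (fun p : Fin C × κ => A p.1 p.2) ≤ a := by
      rw [l2, Fintype.sum_prod_type]
      exact hA
    obtain ⟨v', hv', hv⟩ := exists_mem_stepCover u a b ha hb hu K hK _ hl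
    refine ⟨_, Finset.mem_image_of_mem _ hv', fun c i => ?_⟩
    have := hv (c, i)
    rw [hdot] at this
    exact this

end Perceptron

section Clip

variable {κ : Type*} [Fintype κ]

/-- Radial projection onto the Euclidean ball of radius `b`. -/
noncomputable def clip (b : ℝ) (v : κ → ℝ) : κ → ℝ := (b / max b (l2 v)) • v

theorem l2_smul (c : ℝ) (hc : 0 ≤ c) (v : κ → ℝ) : l2 (c • v) = c * l2 v := by
  rw [l2, l2, ← Real.sqrt_sq hc, ← Real.sqrt_mul (sq_nonneg c), Real.sqrt_sq hc, Finset.mul_sum]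
  simp [mul_pow]

theorem clip_of_le {b : ℝ} (hb : 0 < b) {v : κ → ℝ} (hv : l2 v ≤ b) : clip b v = v := by
  rw [clip, max_eq_left hv, div_self hb.ne', one_smul]

theorem l2_clip_le {b : ℝ} (hb : 0 < b) (v : κ → ℝ) : l2 (clip b v) ≤ b := by
  rw [clip, l2_smul _ (by positivity), div_mul_eq_mul_div, div_le_iff₀ (by positivity)]
  exact mul_le_mul_of_nonneg_left (le_max_right _ _) hb.le

theorem dotProduct_clip_le {b : ℝ} (hb : 0 < b) (v p : κ → ℝ) (hp : l2 p ≤ b) :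
    (v - clip b v) ⬝ᵥ p ≤ (v - clip b v) ⬝ᵥ clip b v := by
  rcases le_or_gt (l2 v) b with h | h
  · rw [clip_of_le hb h, sub_self, zero_dotProduct, zero_dotProduct]
  · have hv0 : 0 < l2 v := hb.trans h
    have hmax : max b (l2 v) = l2 v := max_eq_right h.le
    have hres : v - clip b v = (1 - b / l2 v) • v := by
      rw [clip, hmax, sub_smul, one_smul]
    have hs : 0 ≤ 1 - b / l2 v := by
      rw [sub_nonneg, div_le_one hv0]
      exact h.le
    rw [hres, smul_dotProduct, smul_dotProduct, smul_eq_mul, smul_eq_mul]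
    refine mul_le_mul_of_nonneg_left ?_ hs
    rw [clip, hmax, dotProduct_smul, ← l2_sq, smul_eq_mul]
    calc v ⬝ᵥ p ≤ l2 v * l2 p := (le_abs_self _).trans (abs_dotProduct_le _ _)
      _ ≤ l2 v * b := by gcongr
      _ = _ := by field_simp

/-- Radial projection is `1`-Lipschitz. -/
theorem l2_clip_sub_clip_le {b : ℝ} (hb : 0 < b) (v v' : κ → ℝ) :
    l2 (clip b v - clip b v') ≤ l2 (v - v') := by
  have h1 := dotProduct_clip_le hb v (clip b v') (l2_clip_le hb v')
  have h2 := dotProduct_clip_le hb v' (clip b v) (l2_clip_le hb v)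
  have hsq : l2 (clip b v - clip b v') ^ 2 ≤ l2 (v - v') * l2 (clip b v - clip b v') := by
    refine le_trans ?_ ((le_abs_self _).trans (abs_dotProduct_le _ _))
    rw [l2_sq]
    simp only [sub_dotProduct, dotProduct_sub] at h1 h2 ⊢
    have h3 := dotProduct_comm (clip b v) (clip b v')
    linarith
  by_contra! hlt
  have hpos : 0 < l2 (clip b v - clip b v') := (l2_nonneg _).trans_lt hlt
  nlinarith

end Clip

theorem abs_sup'_sub_sup'_le {α : Type*} (s : Finset α) (hs : s.Nonempty) (g g' : α → ℝ) (e : ℝ)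
    (h : ∀ o ∈ s, |g o - g' o| ≤ e) : |s.sup' hs g - s.sup' hs g'| ≤ e := by
  rw [abs_le]
  constructor
  · have : s.sup' hs g' ≤ s.sup' hs g + e := Finset.sup'_le _ _ fun o ho => by
      have := Finset.le_sup' g ho
      linarith [(abs_le.1 (h o ho)).1]
    linarith
  · have : s.sup' hs g ≤ s.sup' hs g' + e := Finset.sup'_le _ _ fun o ho => by
      have := Finset.le_sup' g' ho
      linarith [(abs_le.1 (h o ho)).2]
    linarith

section Network

variable {d C m dp P w : ℕ} (pt : Fin P → Fin dp → Fin d) (pool : Pooling P w)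

/-- The output of the hidden layer. -/
noncomputable def hidden (A1 : Matrix (Fin m) (Fin dp) ℝ) (x : Fin d → ℝ) : Fin m × Fin w → ℝ :=
  fun q => reluPool pool (conv pt A1 x) q.1 q.2

/-- The network whose hidden layer is projected onto the ball of radius `b`. -/
noncomputable def score (b : ℝ) (A1 : Matrix (Fin m) (Fin dp) ℝ)
    (A2 : Matrix (Fin C) (Fin m × Fin w) ℝ) (x : Fin d → ℝ) (c : Fin C) : ℝ :=
  A2 c ⬝ᵥ clip b (hidden pt pool A1 x)

theorem conv_sub_eq (A1 A1' : Matrix (Fin m) (Fin dp) ℝ) (x : Fin d → ℝ) (f : Fin m)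
    (o : Fin P) : conv pt A1 x f o - conv pt A1' x f o = (A1 f - A1' f) ⬝ᵥ fun i => x (pt o i) := by
  simp only [conv, dotProduct, Pi.sub_apply]
  rw [← Finset.sum_sub_distrib]
  exact Finset.sum_congr rfl fun i _ => by ring

theorem l2_hidden_sub_le (A1 A1' : Matrix (Fin m) (Fin dp) ℝ) (x : Fin d → ℝ) (e : Fin m → ℝ)
    (h : ∀ f o, |(A1 f - A1' f) ⬝ᵥ fun i => x (pt o i)| ≤ e f) :
    l2 (hidden pt pool A1 x - hidden pt pool A1' x) ≤ Real.sqrt w * l2 e := by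
  rw [l2, l2, ← Real.sqrt_mul (Nat.cast_nonneg w)]
  refine Real.sqrt_le_sqrt ?_
  rw [Fintype.sum_prod_type, Finset.mul_sum]
  refine Finset.sum_le_sum fun f _ => ?_
  calc ∑ j, (hidden pt pool A1 x - hidden pt pool A1' x) (f, j) ^ 2
      ≤ ∑ _j : Fin w, e f ^ 2 := by
        refine Finset.sum_le_sum fun j _ => ?_
        rw [← sq_abs]
        refine pow_le_pow_left₀ (abs_nonneg _) ?_ 2
        refine abs_sup'_sub_sup'_le (pool.window j) (pool.nonempty j) _ _ _ fun o _ => ?_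
        refine le_trans ?_ (h f o)
        rw [← conv_sub_eq]
        simpa using abs_max_sub_max_le_max (conv pt A1 x f o) 0 (conv pt A1' x f o) 0
    _ = _ := by simp

/-- Since the pooling windows are disjoint, the hidden output is no longer than the
pre-activations. -/
theorem l2_hidden_le_frob_conv (A1 : Matrix (Fin m) (Fin dp) ℝ) (x : Fin d → ℝ) :
    l2 (hidden pt pool A1 x) ≤ frob (conv pt A1 x) := by
  classical
  refine Real.sqrt_le_sqrt ?_
  rw [Fintype.sum_prod_type]
  refine Finset.sum_le_sum fun f _ => ?_
  calc ∑ j, hidden pt pool A1 x (f, j) ^ 2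
      ≤ ∑ j, ∑ o ∈ pool.window j, conv pt A1 x f o ^ 2 := by
        refine Finset.sum_le_sum fun j _ => ?_
        obtain ⟨o, ho, hoe⟩ := Finset.exists_mem_eq_sup' (pool.nonempty j)
          fun o => max (conv pt A1 x f o) 0
        have : hidden pt pool A1 x (f, j) = max (conv pt A1 x f o) 0 := hoe
        rw [this]
        refine le_trans ?_ (Finset.single_le_sum (f := fun o => conv pt A1 x f o ^ 2)
          (fun _ _ => sq_nonneg _) ho)
        rw [← sq_abs (conv pt A1 x f o)]
        refine pow_le_pow_left₀ (le_max_right _ _) ?_ 2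
        exact max_le (le_abs_self _) (abs_nonneg _)
    _ = ∑ o ∈ Finset.univ.biUnion pool.window, conv pt A1 x f o ^ 2 := by
        rw [Finset.sum_biUnion]
        intro j _ j' _ hj
        exact pool.disjoint j j' hj
    _ ≤ _ := Finset.sum_le_sum_of_subset_of_nonneg (Finset.subset_univ _)
        fun _ _ _ => sq_nonneg _

theorem l2_patch_le {b₀ : ℝ} {x : Fin d → ℝ} (hx : patchNorm pt x ≤ b₀) (o : Fin P) :
    l2 (fun i => x (pt o i)) ≤ b₀ :=
  (le_ciSup (f := fun o : Fin P => Real.sqrt (∑ i, x (pt o i) ^ 2))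
    (Set.finite_range _).bddAbove o).trans hx

theorem abs_score_sub_le {b aStar : ℝ} (hb : 0 < b) (A1 A1' : Matrix (Fin m) (Fin dp) ℝ)
    (A2 A2' : Matrix (Fin C) (Fin m × Fin w) ℝ) (hA2 : ∀ c, l2 (A2 c) ≤ aStar) (x : Fin d → ℝ)
    (e : Fin m → ℝ) (r : ℝ) (he : ∀ f o, |(A1 f - A1' f) ⬝ᵥ fun i => x (pt o i)| ≤ e f)
    (c : Fin C) (hr : |(A2 c - A2' c) ⬝ᵥ clip b (hidden pt pool A1' x)| ≤ r) :
    |score pt pool b A1 A2 x c - score pt pool b A1' A2' x c| ≤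
      aStar * Real.sqrt w * l2 e + r := by
  have hsplit : score pt pool b A1 A2 x c - score pt pool b A1' A2' x c =
      A2 c ⬝ᵥ (clip b (hidden pt pool A1 x) - clip b (hidden pt pool A1' x)) +
        (A2 c - A2' c) ⬝ᵥ clip b (hidden pt pool A1' x) := by
    rw [score, score, dotProduct_sub, sub_dotProduct]
    ring
  rw [hsplit]
  refine (abs_add_le _ _).trans (add_le_add ((abs_dotProduct_le _ _).trans ?_) hr)
  rw [mul_assoc]
  exact mul_le_mul (hA2 c)
    ((l2_clip_sub_clip_le hb _ _).trans (l2_hidden_sub_le pt pool A1 A1' x e he))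
    (l2_nonneg _) ((l2_nonneg _).trans (hA2 c))

/-- The margin of the scores `F` at the label `y`. -/
noncomputable def margin (F : Fin C → ℝ) (y : Fin C) : ℝ := F y - ⨆ c : {c : Fin C // c ≠ y}, F c

theorem abs_margin_sub_le (hC : 1 < C) (F F' : Fin C → ℝ) (y : Fin C) (η : ℝ)
    (h : ∀ c, |F c - F' c| ≤ η) : |margin F y - margin F' y| ≤ 2 * η := by
  have : Nontrivial (Fin C) := Fin.nontrivial_iff_two_le.2 hC
  have : Nonempty {c : Fin C // c ≠ y} := by
    obtain ⟨c, hc⟩ := exists_ne y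
    exact ⟨⟨c, hc⟩⟩
  have key : ∀ F F' : Fin C → ℝ, (∀ c, |F c - F' c| ≤ η) →
      (⨆ c : {c : Fin C // c ≠ y}, F c) ≤ (⨆ c : {c : Fin C // c ≠ y}, F' c) + η := by
    intro F F' h
    refine ciSup_le fun c => ?_
    have := le_ciSup (f := fun c : {c : Fin C // c ≠ y} => F' c) (Set.finite_range _).bddAbove c
    linarith [(abs_le.1 (h c)).2]
  have h1 := key F F' h
  have h2 := key F' F fun c => by rw [abs_sub_comm]; exact h c
  have h3 := abs_le.1 (h y)
  rw [margin, margin, abs_le]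
  constructor <;> linarith [h3.1, h3.2]

/-- A ramp equal to `1` below `9γ/20` and to `0` above `11γ/20`. -/
noncomputable def ramp (γ t : ℝ) : ℝ := max 0 (min 1 ((11 / 20 * γ - t) * (10 / γ)))

theorem ramp_nonneg (γ t : ℝ) : 0 ≤ ramp γ t := le_max_left _ _

theorem ramp_le_one (γ t : ℝ) : ramp γ t ≤ 1 := max_le zero_le_one (min_le_left _ _)

theorem ramp_eq_one {γ t : ℝ} (hγ : 0 < γ) (ht : t ≤ 9 / 20 * γ) : ramp γ t = 1 := by
  have : 1 ≤ (11 / 20 * γ - t) * (10 / γ) := by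
    rw [mul_div_assoc', le_div_iff₀ hγ]
    linarith
  rw [ramp, min_eq_left this, max_eq_right zero_le_one]

theorem ramp_eq_zero {γ t : ℝ} (hγ : 0 < γ) (ht : 11 / 20 * γ ≤ t) : ramp γ t = 0 := by
  have : (11 / 20 * γ - t) * (10 / γ) ≤ 0 :=
    mul_nonpos_of_nonpos_of_nonneg (by linarith) (by positivity)
  rw [ramp, max_eq_left ((min_le_right _ _).trans this)]

theorem abs_ramp_sub_le {γ : ℝ} (hγ : 0 < γ) (t t' : ℝ) :
    |ramp γ t - ramp γ t'| ≤ 10 / γ * |t - t'| := by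
  unfold ramp
  refine (abs_max_sub_max_le_max _ _ _ _).trans ?_
  rw [sub_self, abs_zero, max_eq_right (abs_nonneg _)]
  refine (abs_min_sub_min_le_max _ _ _ _).trans ?_
  rw [sub_self, abs_zero, max_eq_right (abs_nonneg _), ← sub_mul, abs_mul,
    abs_of_pos (show (0 : ℝ) < 10 / γ by positivity), mul_comm]
  refine mul_le_mul_of_nonneg_left (le_of_eq ?_) (by positivity)
  rw [← abs_neg]
  congr 1
  ring

theorem measurable_conv (A1 : Matrix (Fin m) (Fin dp) ℝ) (f : Fin m) (o : Fin P) :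
    Measurable fun x : Fin d → ℝ => conv pt A1 x f o :=
  Finset.measurable_sum _ fun _ _ => (measurable_pi_apply _).mul_const _

theorem measurable_hidden (A1 : Matrix (Fin m) (Fin dp) ℝ) (q : Fin m × Fin w) :
    Measurable fun x : Fin d → ℝ => hidden pt pool A1 x q := by
  have := Finset.measurable_sup' (pool.nonempty q.2)
    (f := fun o (x : Fin d → ℝ) => max (conv pt A1 x q.1 o) 0)
    fun o _ => (measurable_conv pt A1 q.1 o).max measurable_const
  convert this using 1
  ext x
  simp [hidden, reluPool, Finset.sup'_apply]

theorem measurable_score (b : ℝ) (A1 : Matrix (Fin m) (Fin dp) ℝ)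
    (A2 : Matrix (Fin C) (Fin m × Fin w) ℝ) (c : Fin C) :
    Measurable fun x : Fin d → ℝ => score pt pool b A1 A2 x c := by
  have hl : Measurable fun x : Fin d → ℝ => l2 (hidden pt pool A1 x) :=
    (Finset.measurable_sum _ fun q _ => (measurable_hidden pt pool A1 q).pow_const 2).sqrt
  refine Finset.measurable_sum _ fun q _ => Measurable.const_mul ?_ _
  exact ((measurable_const.max hl).const_div b).mul (measurable_hidden pt pool A1 q)

/-- The margin loss of the clipped network. -/
noncomputable def loss (γ b : ℝ) (A1 : Matrix (Fin m) (Fin dp) ℝ)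
    (A2 : Matrix (Fin C) (Fin m × Fin w) ℝ) (p : (Fin d → ℝ) × Fin C) : ℝ :=
  ramp γ (margin (score pt pool b A1 A2 p.1) p.2)

theorem measurable_loss (γ b : ℝ) (A1 : Matrix (Fin m) (Fin dp) ℝ)
    (A2 : Matrix (Fin C) (Fin m × Fin w) ℝ) : Measurable (loss pt pool γ b A1 A2) := by
  refine measurable_from_prod_countable_left fun y => ?_
  have hs : Measurable fun x : Fin d → ℝ => ⨆ c : {c : Fin C // c ≠ y},
      score pt pool b A1 A2 x c := Measurable.iSup fun c => measurable_score pt pool b A1 A2 c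
  have hm := (measurable_score pt pool b A1 A2 y).sub hs
  exact measurable_const.max (measurable_const.min ((hm.const_sub _).mul_const _))

theorem loss_nonneg (γ b : ℝ) (A1 : Matrix (Fin m) (Fin dp) ℝ)
    (A2 : Matrix (Fin C) (Fin m × Fin w) ℝ) (p : (Fin d → ℝ) × Fin C) :
    0 ≤ loss pt pool γ b A1 A2 p := ramp_nonneg _ _

theorem loss_le_one (γ b : ℝ) (A1 : Matrix (Fin m) (Fin dp) ℝ)
    (A2 : Matrix (Fin C) (Fin m × Fin w) ℝ) (p : (Fin d → ℝ) × Fin C) :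
    loss pt pool γ b A1 A2 p ≤ 1 := ramp_le_one _ _

theorem integrable_loss (μ : Measure ((Fin d → ℝ) × Fin C)) [IsFiniteMeasure μ] (γ b : ℝ)
    (A1 : Matrix (Fin m) (Fin dp) ℝ) (A2 : Matrix (Fin C) (Fin m × Fin w) ℝ) :
    Integrable (loss pt pool γ b A1 A2) μ :=
  integrable_of_abs_le (measurable_loss pt pool γ b A1 A2) 1 fun p => by
    rw [abs_of_nonneg (loss_nonneg pt pool γ b A1 A2 p)]
    exact loss_le_one pt pool γ b A1 A2 p

theorem abs_loss_sub_le (hC : 1 < C) {γ b aStar : ℝ} (hγ : 0 < γ) (hb : 0 < b)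
    (A1 A1' : Matrix (Fin m) (Fin dp) ℝ)
    (A2 A2' : Matrix (Fin C) (Fin m × Fin w) ℝ) (hA2 : ∀ c, l2 (A2 c) ≤ aStar)
    (p : (Fin d → ℝ) × Fin C)
    (e : Fin m → ℝ) (r : ℝ) (he : ∀ f o, |(A1 f - A1' f) ⬝ᵥ fun i => p.1 (pt o i)| ≤ e f)
    (hr : ∀ c, |(A2 c - A2' c) ⬝ᵥ clip b (hidden pt pool A1' p.1)| ≤ r) :
    |loss pt pool γ b A1 A2 p - loss pt pool γ b A1' A2' p| ≤
      20 / γ * (aStar * Real.sqrt w * l2 e + r) := by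
  refine (abs_ramp_sub_le hγ _ _).trans ?_
  have := abs_margin_sub_le hC _ _ p.2 _ fun c =>
    abs_score_sub_le pt pool hb A1 A1' A2 A2' hA2 p.1 e r he c (hr c)
  refine (mul_le_mul_of_nonneg_left this (by positivity)).trans (le_of_eq ?_)
  ring

/-- Clipping the hidden layer rescales the scores, hence keeps the misclassified points. -/
theorem margin_score_nonpos {b : ℝ} (hb : 0 < b) (A1 : Matrix (Fin m) (Fin dp) ℝ)
    (A2 : Matrix (Fin C) (Fin m × Fin w) ℝ) (p : (Fin d → ℝ) × Fin C)
    (hp : p ∈ errorSet (net pt pool A1 A2)) : margin (score pt pool b A1 A2 p.1) p.2 ≤ 0 := by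
  obtain ⟨c, hc, hle⟩ := hp
  have hs : ∀ c, score pt pool b A1 A2 p.1 c =
      b / max b (l2 (hidden pt pool A1 p.1)) * net pt pool A1 A2 p.1 c := fun c => by
    rw [score, clip, dotProduct_smul, smul_eq_mul]
    rfl
  have h1 := le_ciSup (f := fun c : {c : Fin C // c ≠ p.2} => score pt pool b A1 A2 p.1 c)
    (Set.finite_range _).bddAbove ⟨c, hc⟩
  have h2 : score pt pool b A1 A2 p.1 p.2 ≤ score pt pool b A1 A2 p.1 c := by
    rw [hs, hs]
    exact mul_le_mul_of_nonneg_left hle (by positivity)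
  rw [margin]
  linarith

theorem score_eq_net {b : ℝ} (hb : 0 < b) (A1 : Matrix (Fin m) (Fin dp) ℝ)
    (A2 : Matrix (Fin C) (Fin m × Fin w) ℝ) (x : Fin d → ℝ) (hx : frob (conv pt A1 x) ≤ b) :
    score pt pool b A1 A2 x = net pt pool A1 A2 x := by
  funext c
  rw [score, clip_of_le hb ((l2_hidden_le_frob_conv pt pool A1 x).trans hx)]
  rfl

end Network

section Covers

variable {ι κ : Type*} {d C m dp P w : ℕ}

/-- `A'` predicts like `A` on all vectors `u k o`, up to errors whose `ℓ²` norm over the rows is at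
most `r`. -/
def RowClose (u : κ → Fin P → Fin dp → ℝ) (r : ℝ) (A A' : Matrix (Fin m) (Fin dp) ℝ) : Prop :=
  ∃ e : Fin m → ℝ, (∀ f k o, |(A f - A' f) ⬝ᵥ u k o| ≤ e f) ∧ l2 e ≤ r

/-- Covers of a family of first-layer matrices at every scale. -/
def FirstLayerCovers (u : κ → Fin P → Fin dp → ℝ) (A : ι → Matrix (Fin m) (Fin dp) ℝ)
    (X r : ℝ) : Prop :=
  (∃ A', ∀ i, RowClose u r (A i) A') ∧
    ∀ K : ℕ, 0 < K → ∃ V : Finset (Matrix (Fin m) (Fin dp) ℝ), (V.card : ℝ) ≤ X ^ K ∧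
      ∀ i, ∃ A' ∈ V, RowClose u (r / Real.sqrt K) (A i) A'

/-- Covers of a family of second-layer matrices at every scale, for all hidden representations
bounded by `b`. -/
def SecondLayerCovers (κ : Type*) (b : ℝ) (A : ι → Matrix (Fin C) (Fin m × Fin w) ℝ)
    (X r : ℝ) : Prop :=
  ∀ h : κ → Fin m × Fin w → ℝ, (∀ k, l2 (h k) ≤ b) →
    (∃ A' : Matrix (Fin C) (Fin m × Fin w) ℝ, ∀ i c k, |(A i c - A' c) ⬝ᵥ h k| ≤ r) ∧
    ∀ K : ℕ, 0 < K → ∃ V : Finset (Matrix (Fin C) (Fin m × Fin w) ℝ), (V.card : ℝ) ≤ X ^ K ∧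
      ∀ i, ∃ A' ∈ V, ∀ c k, |(A i c - A' c) ⬝ᵥ h k| ≤ r / Real.sqrt K

theorem rowClose_self (u : κ → Fin P → Fin dp → ℝ) (A : Matrix (Fin m) (Fin dp) ℝ) :
    RowClose u 0 A A :=
  ⟨0, by simp, by simp [l2]⟩

theorem firstLayerCovers_const (u : κ → Fin P → Fin dp → ℝ) (A : ι → Matrix (Fin m) (Fin dp) ℝ)
    (M : Matrix (Fin m) (Fin dp) ℝ) (hA : ∀ i, A i = M) : FirstLayerCovers u A 1 0 := by
  refine ⟨⟨M, fun i => by rw [hA]; exact rowClose_self u M⟩, fun K _ => ⟨{M}, by simp, fun i =>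
    ⟨M, Finset.mem_singleton_self _, ?_⟩⟩⟩
  rw [hA, zero_div]
  exact rowClose_self u M

theorem secondLayerCovers_const (b : ℝ) (A : ι → Matrix (Fin C) (Fin m × Fin w) ℝ)
    (M : Matrix (Fin C) (Fin m × Fin w) ℝ) (hA : ∀ i, A i = M) :
    SecondLayerCovers κ b A 1 0 := by
  refine fun h _ => ⟨⟨M, fun i c k => by simp [hA]⟩, fun K _ => ⟨{M}, by simp, fun i =>
    ⟨M, Finset.mem_singleton_self _, fun c k => by simp [hA]⟩⟩⟩

theorem l2_le_sum_abs {n : ℕ} (e : Fin n → ℝ) (he : ∀ f, 0 ≤ e f) : l2 e ≤ ∑ f, e f := by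
  rw [l2, Real.sqrt_le_left (Finset.sum_nonneg fun f _ => he f), sq, Finset.sum_mul]
  refine Finset.sum_le_sum fun f _ => ?_
  rw [sq]
  exact mul_le_mul_of_nonneg_left
    (Finset.single_le_sum (fun g _ => he g) (Finset.mem_univ f)) (he f)

theorem rowClose_of_l2_le {u : κ → Fin P → Fin dp → ℝ} {b : ℝ} (hb : 0 ≤ b)
    (hu : ∀ k o, l2 (u k o) ≤ b) (A A' : Matrix (Fin m) (Fin dp) ℝ) :
    RowClose u (rowSum21 (A - A') * b) A A' := by
  refine ⟨fun f => l2 (A f - A' f) * b, fun f k o => (abs_dotProduct_le _ _).trans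
    (mul_le_mul_of_nonneg_left (hu k o) (l2_nonneg _)), ?_⟩
  refine (l2_le_sum_abs _ fun f => mul_nonneg (l2_nonneg _) hb).trans (le_of_eq ?_)
  rw [← Finset.sum_mul]
  rfl

theorem firstLayerCovers_of_rowSum21_le [Fintype κ] (u : κ → Fin P → Fin dp → ℝ)
    (A : ι → Matrix (Fin m) (Fin dp) ℝ) (M : Matrix (Fin m) (Fin dp) ℝ) {a b : ℝ} (ha : 0 < a)
    (hb : 0 < b) (hu : ∀ k o, l2 (u k o) ≤ b) (hA : ∀ i, rowSum21 (A i - M) ≤ a) :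
    FirstLayerCovers u A ((m + 1) * (2 * (Fintype.card κ * P) + 1)) (2 * a * b) := by
  classical
  constructor
  · refine ⟨M, fun i => ?_⟩
    obtain ⟨e, he, hl⟩ := rowClose_of_l2_le hb.le hu (A i) M
    refine ⟨e, he, hl.trans ?_⟩
    have := mul_le_mul_of_nonneg_right (hA i) hb.le
    have := mul_pos ha hb
    linarith
  · intro K hK
    obtain ⟨V, hV, hcov⟩ := exists_rowwise_cover m (fun p : κ × Fin P => u p.1 p.2) a b ha hb
      (fun p => hu _ _) K hK
    refine ⟨V.image fun B => M + Matrix.of B, ?_, fun i => ?_⟩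
    · refine le_trans (Nat.cast_le.2 (Finset.card_image_le.trans hV)) (le_of_eq ?_)
      simp
    · obtain ⟨B, hB, e, he, -, hl⟩ := hcov (fun f => A i f - M f) (hA i)
      refine ⟨_, Finset.mem_image_of_mem _ hB, e, fun f k o => ?_, hl⟩
      have := he f (k, o)
      rw [sub_sub] at this
      exact this

theorem l2_row_le_frob {κ' : Type*} [Fintype κ'] (A : Fin C → κ' → ℝ) (c : Fin C) :
    l2 (A c) ≤ frob A :=
  Real.sqrt_le_sqrt (Finset.single_le_sum (f := fun c => ∑ q, A c q ^ 2)
    (fun _ _ => Finset.sum_nonneg fun _ _ => sq_nonneg _) (Finset.mem_univ c))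

theorem secondLayerCovers_of_frob_le [Fintype κ] {a b : ℝ} (ha : 0 < a) (hb : 0 < b)
    (A : ι → Matrix (Fin C) (Fin m × Fin w) ℝ) (M : Matrix (Fin C) (Fin m × Fin w) ℝ)
    (hA : ∀ i, frob (A i - M) ≤ a) :
    SecondLayerCovers κ b A (2 * (C * Fintype.card κ) + 1) (a * b) := by
  classical
  intro h hh
  constructor
  · refine ⟨M, fun i c k => (abs_dotProduct_le _ _).trans ?_⟩
    exact mul_le_mul ((l2_row_le_frob (A i - M) c).trans (hA i)) (hh k) (l2_nonneg _) ha.le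
  · intro K hK
    obtain ⟨V, hV, hcov⟩ := exists_frobenius_cover C h a b ha hb hh K hK
    refine ⟨V.image fun B => M + Matrix.of B, ?_, fun i => ?_⟩
    · refine le_trans (Nat.cast_le.2 (Finset.card_image_le.trans hV)) (le_of_eq ?_)
      simp
    · obtain ⟨B, hB, he⟩ := hcov (fun c => A i c - M c) (hA i)
      refine ⟨_, Finset.mem_image_of_mem _ hB, fun c k => ?_⟩
      have := he c k
      rw [sub_sub] at this
      exact this

/-- Covers of the two layers combine to covers of the losses. -/
theorem hasCovers_loss (hC : 1 < C) (pt : Fin P → Fin dp → Fin d) (pool : Pooling P w)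
    {γ b aStar : ℝ} (hγ : 0 < γ) (hb : 0 < b) (ha : 0 < aStar)
    (A1 : ι → Matrix (Fin m) (Fin dp) ℝ) (A2 : ι → Matrix (Fin C) (Fin m × Fin w) ℝ)
    (hA2 : ∀ i c, l2 (A2 i c) ≤ aStar) (z : κ → (Fin d → ℝ) × Fin C) (X₁ X₂ r₁ r₂ : ℝ)
    (hX₂ : 0 ≤ X₂)
    (h₁ : FirstLayerCovers (fun k o i => (z k).1 (pt o i)) A1 X₁ r₁)
    (h₂ : SecondLayerCovers κ b A2 X₂ r₂) :
    HasCovers (fun i k => loss pt pool γ b (A1 i) (A2 i) (z k)) (X₁ * X₂)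
      (20 / γ * (aStar * Real.sqrt w * r₁ + r₂)) := by
  classical
  have hclip : ∀ (B : Matrix (Fin m) (Fin dp) ℝ) k, l2 (clip b (hidden pt pool B (z k).1)) ≤ b :=
    fun B k => l2_clip_le hb _
  constructor
  · obtain ⟨B1, hB1⟩ := h₁.1
    obtain ⟨B2, hB2⟩ := (h₂ _ (hclip B1)).1
    refine ⟨fun k => loss pt pool γ b B1 B2 (z k), fun i k => ?_⟩
    obtain ⟨e, he, hl⟩ := hB1 i
    refine (abs_loss_sub_le pt pool hC hγ hb _ _ _ _ (hA2 i) (z k) e r₂ (fun f o => he f k o)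
      fun c => hB2 i c k).trans ?_
    gcongr
  · intro K hK
    obtain ⟨V1, hV1, hc1⟩ := h₁.2 K hK
    choose V2 hV2 hc2 using fun B1 => (h₂ _ (hclip B1)).2 K hK
    refine ⟨V1.biUnion fun B1 => (V2 B1).image fun B2 k => loss pt pool γ b B1 B2 (z k), ?_,
      fun i => ?_⟩
    · calc _ ≤ ((∑ B1 ∈ V1, ((V2 B1).image
            fun B2 k => loss pt pool γ b B1 B2 (z k)).card : ℕ) : ℝ) := by
            exact_mod_cast Finset.card_biUnion_le
        _ ≤ ∑ B1 ∈ V1, X₂ ^ K := by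
            push_cast
            refine Finset.sum_le_sum fun B1 _ => le_trans ?_ (hV2 B1)
            exact_mod_cast Finset.card_image_le
        _ = V1.card * X₂ ^ K := by simp
        _ ≤ X₁ ^ K * X₂ ^ K := by gcongr
        _ = (X₁ * X₂) ^ K := (mul_pow _ _ _).symm
    · obtain ⟨B1, hB1, e, he, hl⟩ := hc1 i
      obtain ⟨B2, hB2, hr⟩ := hc2 B1 i
      refine ⟨_, Finset.mem_biUnion.2 ⟨B1, hB1, Finset.mem_image_of_mem _ hB2⟩, fun k => ?_⟩
      refine (abs_loss_sub_le pt pool hC hγ hb _ _ _ _ (hA2 i) (z k) e _ (fun f o => he f k o)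
        fun c => hr c k).trans ?_
      rw [mul_div_assoc, add_div, mul_div_assoc (aStar * Real.sqrt w)]
      gcongr

end Covers

/-- Bounded sets of matrices have finite nets in the largest row norm. -/
theorem exists_finite_row_net {α β : Type*} [Fintype α] [Fintype β] (S : Set (α → β → ℝ))
    (M : α → β → ℝ) (R : ℝ) (hS : ∀ A ∈ S, ∀ i, l2 (A i - M i) ≤ R) (η : ℝ) (hη : 0 < η) :
    ∃ T : Set (α → β → ℝ), T.Finite ∧ T ⊆ S ∧ ∀ A ∈ S, ∃ A' ∈ T, ∀ i, l2 (A i - A' i) ≤ η := by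
  have hentry : ∀ (v : β → ℝ) j, |v j| ≤ l2 v := fun v j => by
    rw [l2, ← Real.sqrt_sq_eq_abs]
    exact Real.sqrt_le_sqrt (Finset.single_le_sum (f := fun j => v j ^ 2)
      (fun _ _ => sq_nonneg _) (Finset.mem_univ j))
  have hbd : Bornology.IsBounded S := by
    refine (Metric.isBounded_iff_subset_closedBall M).2 ⟨max R 0, fun A hA => ?_⟩
    rw [Metric.mem_closedBall, dist_pi_le_iff (le_max_right _ _)]
    intro i
    rw [dist_pi_le_iff (le_max_right _ _)]
    intro j
    exact ((hentry (A i - M i) j).trans (hS A hA i)).trans (le_max_left _ _)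
  have htb : TotallyBounded S := hbd.isCompact_closure.totallyBounded.subset subset_closure
  set η' : ℝ := η / (Real.sqrt (Fintype.card β) + 1) with hη'
  have hη0 : 0 < η' := by positivity
  obtain ⟨T, hTS, hTf, hT⟩ := Metric.finite_approx_of_totallyBounded htb η' hη0
  refine ⟨T, hTf, hTS, fun A hA => ?_⟩
  obtain ⟨A', hA', hd⟩ := Set.mem_iUnion₂.1 (hT hA)
  refine ⟨A', hA', fun i => ?_⟩
  have hd' : ∀ j, |(A i - A' i) j| ≤ η' := fun j =>
    ((dist_le_pi_dist (A i) (A' i) j).trans (dist_le_pi_dist A A' i)).trans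
      (Metric.mem_ball.1 hd).le
  calc l2 (A i - A' i) ≤ Real.sqrt (∑ _j : β, η' ^ 2) := by
        refine Real.sqrt_le_sqrt (Finset.sum_le_sum fun j _ => ?_)
        rw [← sq_abs]
        exact pow_le_pow_left₀ (abs_nonneg _) (hd' j) 2
    _ = Real.sqrt (Fintype.card β) * η' := by
        rw [Finset.sum_const, Finset.card_univ, nsmul_eq_mul, Real.sqrt_mul (Nat.cast_nonneg _),
          Real.sqrt_sq hη0.le]
    _ ≤ (Real.sqrt (Fintype.card β) + 1) * η' := by gcongr; linarith
    _ = η := by rw [hη']; field_simp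

theorem HasCovers.comp {ι ι' κ : Type*} {f : ι → κ → ℝ} {X X' ρ : ℝ} (h : HasCovers f X ρ)
    (hX : 0 ≤ X) (hXX' : X ≤ X') (g : ι' → ι) : HasCovers (fun i => f (g i)) X' ρ := by
  obtain ⟨⟨c, hc⟩, hV⟩ := h
  refine ⟨⟨c, fun i => hc (g i)⟩, fun K hK => ?_⟩
  obtain ⟨V, hVc, hVf⟩ := hV K hK
  exact ⟨V, hVc.trans (pow_le_pow_left₀ hX hXX' K), fun i => hVf (g i)⟩

section Deviation

variable {d C m dp P w n : ℕ}

/-- Uniform deviation of the loss over possibly infinite parameter sets, by reduction to a finite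
net. -/
theorem measure_exists_loss_deviation_le (hC : 1 < C) (hn : 0 < n)
    (pt : Fin P → Fin dp → Fin d) (pool : Pooling P w)
    (μ : Measure ((Fin d → ℝ) × Fin C)) [IsProbabilityMeasure μ]
    {γ b₀ b aStar : ℝ} (hγ : 0 < γ) (hb₀ : 0 < b₀) (hb : 0 < b) (ha : 0 < aStar)
    (hμ : ∀ᵐ p ∂μ, patchNorm pt p.1 ≤ b₀)
    (S₁ : Set (Matrix (Fin m) (Fin dp) ℝ)) (S₂ : Set (Matrix (Fin C) (Fin m × Fin w) ℝ))
    (M : Matrix (Fin m) (Fin dp) ℝ) (R : ℝ) (hS₁ : ∀ A ∈ S₁, ∀ f, l2 (A f - M f) ≤ R)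
    (hS₂ : ∀ A ∈ S₂, ∀ c, l2 (A c) ≤ aStar) (X₁ X₂ X r₁ r₂ : ℝ) (hX₁ : 0 ≤ X₁) (hX₂ : 0 ≤ X₂)
    (hX : 1 < X) (hXX : X₁ * X₂ ≤ X) (hr₁ : 0 ≤ r₁) (hr₂ : 0 ≤ r₂)
    (h₁ : ∀ u : Fin n ⊕ Fin n → Fin P → Fin dp → ℝ, (∀ k o, l2 (u k o) ≤ b₀) →
      FirstLayerCovers u (fun p : S₁ × S₂ => (p.1 : Matrix (Fin m) (Fin dp) ℝ)) X₁ r₁)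
    (h₂ : SecondLayerCovers (Fin n ⊕ Fin n) b
      (fun p : S₁ × S₂ => (p.2 : Matrix (Fin C) (Fin m × Fin w) ℝ)) X₂ r₂)
    (ρ : ℝ) (hρ : ρ = 20 / γ * (aStar * Real.sqrt w * r₁ + r₂)) (J : ℕ) (t : ℝ) (ht : 0 < t) :
    (Measure.pi fun _ : Fin n => μ) {s | ∃ A1 ∈ S₁, ∃ A2 ∈ S₂,
        (∑ k, loss pt pool γ b A1 A2 (s k)) / n +
          (J * (10 * ρ * Real.sqrt (Real.log X / n)) + 2 * ρ / 2 ^ J) + 3 * t ≤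
            ∫ p, loss pt pool γ b A1 A2 p ∂μ} ≤
      ENNReal.ofReal (Real.exp (-(2 * n * t ^ 2))) := by
  have hn' : (0 : ℝ) < n := by exact_mod_cast hn
  set Q : ℝ := 20 / γ * (aStar * Real.sqrt w * (m * b₀) + b) with hQ
  have hQ0 : 0 < Q := by positivity
  set η : ℝ := t / Q with hη
  have hη0 : 0 < η := by positivity
  obtain ⟨T₁, hT₁f, hT₁S, hT₁⟩ : ∃ T : Set (Matrix (Fin m) (Fin dp) ℝ), T.Finite ∧ T ⊆ S₁ ∧
      ∀ A ∈ S₁, ∃ A' ∈ T, ∀ i, l2 (A i - A' i) ≤ η := exists_finite_row_net S₁ M R hS₁ η hη0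
  obtain ⟨T₂, hT₂f, hT₂S, hT₂⟩ : ∃ T : Set (Matrix (Fin C) (Fin m × Fin w) ℝ), T.Finite ∧
      T ⊆ S₂ ∧ ∀ A ∈ S₂, ∃ A' ∈ T, ∀ i, l2 (A i - A' i) ≤ η :=
    exists_finite_row_net S₂ 0 aStar (fun A hA c => by simpa using hS₂ A hA c) η hη0
  have : Finite T₁ := hT₁f
  have : Finite T₂ := hT₂f
  let g : T₁ × T₂ → S₁ × S₂ := fun p => (⟨p.1.1, hT₁S p.1.2⟩, ⟨p.2.1, hT₂S p.2.2⟩)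
  have hdev := measure_exists_deviation_le μ
    (fun (p : T₁ × T₂) x => loss pt pool γ b p.1.1 p.2.1 x)
    (fun p => measurable_loss pt pool γ b _ _) (fun _ => loss_nonneg pt pool γ b _ _)
    (fun _ => loss_le_one pt pool γ b _ _) {p | patchNorm pt p.1 ≤ b₀} hμ n hn X ρ hX
    (by rw [hρ]; positivity) (fun z hz => by
      have := hasCovers_loss hC pt pool hγ hb ha
        (fun p : S₁ × S₂ => (p.1 : Matrix (Fin m) (Fin dp) ℝ))
        (fun p : S₁ × S₂ => (p.2 : Matrix (Fin C) (Fin m × Fin w) ℝ))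
        (fun p c => hS₂ _ p.2.2 c) z X₁ X₂ r₁ r₂ hX₂
        (h₁ _ fun k o => l2_patch_le pt (hz k) o) h₂
      rw [hρ]
      exact this.comp (mul_nonneg hX₁ hX₂) hXX g) J t ht.le
  have hbad : (Measure.pi fun _ : Fin n => μ) {s | ¬ ∀ k, patchNorm pt (s k).1 ≤ b₀} = 0 :=
    ae_iff.1 (Filter.eventually_all.2 fun k =>
      (Measure.tendsto_eval_ae_ae (μ := fun _ : Fin n => μ) (i := k)).eventually hμ)
  refine le_trans (measure_mono ?_) ((measure_union_le _ _).trans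
    ((add_le_add hbad.le hdev).trans (zero_add _).le))
  rintro s ⟨A1, hA1, A2, hA2, hs⟩
  by_cases hgood : ∀ k, patchNorm pt (s k).1 ≤ b₀
  swap
  · exact Or.inl hgood
  right
  obtain ⟨B1, hB1, hd1⟩ := hT₁ A1 hA1
  obtain ⟨B2, hB2, hd2⟩ := hT₂ A2 hA2
  have hclose : ∀ p : (Fin d → ℝ) × Fin C, patchNorm pt p.1 ≤ b₀ →
      |loss pt pool γ b A1 A2 p - loss pt pool γ b B1 B2 p| ≤ t := by
    intro p hp
    refine (abs_loss_sub_le pt pool hC hγ hb A1 B1 A2 B2 (hS₂ A2 hA2) p (fun _ => η * b₀) (η * b)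
      (fun f o => (abs_dotProduct_le _ _).trans
        (mul_le_mul (hd1 f) (l2_patch_le pt hp o) (l2_nonneg _) hη0.le))
      (fun c => (abs_dotProduct_le _ _).trans
        (mul_le_mul (hd2 c) (l2_clip_le hb _) (l2_nonneg _) hη0.le))).trans ?_
    have hl : l2 (fun _ : Fin m => η * b₀) ≤ m * (η * b₀) :=
      (l2_le_sum_abs _ fun _ => by positivity).trans (le_of_eq (by simp))
    calc 20 / γ * (aStar * Real.sqrt w * l2 (fun _ : Fin m => η * b₀) + η * b)
        ≤ 20 / γ * (aStar * Real.sqrt w * (m * (η * b₀)) + η * b) := by gcongr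
      _ = η * Q := by rw [hQ]; ring
      _ = t := by rw [hη]; field_simp
  have hint := integrable_loss (C := C) (m := m) pt pool μ γ b
  have h1 : ∫ p, loss pt pool γ b A1 A2 p ∂μ ≤ ∫ p, loss pt pool γ b B1 B2 p ∂μ + t := by
    have : ∫ p, (loss pt pool γ b B1 B2 p + t) ∂μ = ∫ p, loss pt pool γ b B1 B2 p ∂μ + t := by
      rw [integral_add (hint _ _) (integrable_const _)]
      simp
    rw [← this]
    refine integral_mono_ae (hint _ _) ((hint _ _).add (integrable_const _)) ?_
    filter_upwards [hμ] with p hp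
    linarith [(abs_le.1 (hclose p hp)).2]
  have h2 : (∑ k, loss pt pool γ b B1 B2 (s k)) / n ≤
      (∑ k, loss pt pool γ b A1 A2 (s k)) / n + t := by
    have : ∑ k, loss pt pool γ b B1 B2 (s k) ≤ ∑ k, loss pt pool γ b A1 A2 (s k) + n * t := by
      calc _ ≤ ∑ k, (loss pt pool γ b A1 A2 (s k) + t) :=
            Finset.sum_le_sum fun k _ => by linarith [(abs_le.1 (hclose (s k) (hgood k))).1]
        _ = _ := by rw [Finset.sum_add_distrib]; simp
    calc _ ≤ (∑ k, loss pt pool γ b A1 A2 (s k) + n * t) / n := by gcongr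
      _ = _ := by field_simp
  refine ⟨(⟨B1, hB1⟩, ⟨B2, hB2⟩), ?_⟩
  simp only
  linarith

/-- From the loss of an approximating network to the error and the margin risk. -/
theorem error_le_integral_loss (hC : 1 < C) (pt : Fin P → Fin dp → Fin d) (pool : Pooling P w)
    (μ : Measure ((Fin d → ℝ) × Fin C)) [IsProbabilityMeasure μ]
    {γ b₀ b : ℝ} (hγ : 0 < γ) (hb : 0 < b)
    (hμ : ∀ᵐ p ∂μ, patchNorm pt p.1 ≤ b₀)
    (A1 B1 : Matrix (Fin m) (Fin dp) ℝ) (A2 B2 : Matrix (Fin C) (Fin m × Fin w) ℝ)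
    (hclose : ∀ x : Fin d → ℝ, patchNorm pt x ≤ b₀ → ∀ c,
      |score pt pool b A1 A2 x c - score pt pool b B1 B2 x c| ≤ 9 / 40 * γ) :
    μ.real (errorSet (net pt pool A1 A2)) ≤ ∫ p, loss pt pool γ b B1 B2 p ∂μ := by
  have hm := measurable_loss pt pool γ b B1 B2
  have hset : MeasurableSet {p | (1 : ℝ) ≤ loss pt pool γ b B1 B2 p} :=
    measurableSet_le measurable_const hm
  have hle : μ.real (errorSet (net pt pool A1 A2)) ≤
      μ.real {p | (1 : ℝ) ≤ loss pt pool γ b B1 B2 p} := by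
    refine ENNReal.toReal_mono (measure_ne_top _ _) (measure_mono_ae ?_)
    filter_upwards [hμ] with p hp herr
    have h1 := margin_score_nonpos pt pool hb A1 A2 p herr
    have h2 := abs_le.1 (abs_margin_sub_le hC _ _ p.2 _ (hclose p.1 hp))
    exact (ramp_eq_one hγ (by linarith [h2.1])).ge
  refine hle.trans ?_
  rw [← integral_indicator_one hset]
  refine integral_mono ((integrable_const (1 : ℝ)).indicator hset)
    (integrable_loss pt pool μ γ b B1 B2) fun p => ?_
  by_cases hp : p ∈ {p | (1 : ℝ) ≤ loss pt pool γ b B1 B2 p}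
  · rw [Set.indicator_of_mem hp]
    exact hp
  · rw [Set.indicator_of_notMem hp]
    exact ramp_nonneg _ _

theorem sum_loss_div_le_marginRisk (hC : 1 < C) (pt : Fin P → Fin dp → Fin d)
    (pool : Pooling P w) {γ b₀ b : ℝ} (hγ : 0 < γ) (hb : 0 < b)
    (A1 B1 : Matrix (Fin m) (Fin dp) ℝ) (A2 B2 : Matrix (Fin C) (Fin m × Fin w) ℝ)
    (hclose : ∀ x : Fin d → ℝ, patchNorm pt x ≤ b₀ → ∀ c,
      |score pt pool b A1 A2 x c - score pt pool b B1 B2 x c| ≤ 9 / 40 * γ)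
    (s : Fin n → (Fin d → ℝ) × Fin C) (hs : ∀ k, patchNorm pt (s k).1 ≤ b₀)
    (hA1 : ∀ k, frob (conv pt A1 (s k).1) ≤ b) :
    (∑ k, loss pt pool γ b B1 B2 (s k)) / n ≤ marginRisk γ (net pt pool A1 A2) s := by
  classical
  rw [marginRisk]
  refine div_le_div_of_nonneg_right ?_ (Nat.cast_nonneg n)
  rw [Set.ncard_eq_toFinset_card', Finset.card_eq_sum_ones, Nat.cast_sum]
  rw [← Finset.sum_subset (Finset.subset_univ {i : Fin n |
    net pt pool A1 A2 (s i).1 (s i).2 ≤ γ +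
      ⨆ c : {c : Fin C // c ≠ (s i).2}, net pt pool A1 A2 (s i).1 c}.toFinset)]
  · refine Finset.sum_le_sum fun k _ => ?_
    simpa using loss_le_one pt pool γ b B1 B2 (s k)
  · intro k _ hk
    rw [Set.mem_toFinset, Set.mem_ofPred_eq, not_le] at hk
    have h2 := abs_le.1 (abs_margin_sub_le hC _ _ (s k).2 _ (hclose (s k).1 (hs k)))
    refine ramp_eq_zero hγ ?_
    have h3 : γ < margin (score pt pool b A1 A2 (s k).1) (s k).2 := by
      rw [score_eq_net pt pool hb A1 A2 _ (hA1 k), margin]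
      linarith
    linarith [h2.2]

end Deviation

section Numerics

theorem ten_mul_le_pow {n v x : ℝ} (hn : 4 ≤ n) (hv : 1 ≤ v) (hx : n ^ 2 * v / 8 ≤ x) :
    2 ≤ x ∧ 10 * (n * v) ≤ x ^ 6 := by
  have hn3 : 64 ≤ n ^ 3 := by
    have := pow_le_pow_left₀ (by norm_num) hn 3
    linarith
  have hn2 : 16 ≤ n ^ 2 := by
    have := pow_le_pow_left₀ (by norm_num) hn 2
    linarith
  have hy2 : 2 ≤ n ^ 2 * v / 8 := by nlinarith
  refine ⟨hy2.trans hx, ?_⟩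
  have hy4 : 16 ≤ x ^ 4 := by
    have := pow_le_pow_left₀ (by norm_num) (hy2.trans hx) 4
    linarith
  have hnv : n * v ≤ x ^ 2 := by
    have h1 := pow_le_pow_left₀ (by linarith) hx 2
    have h2 : (n ^ 2 * v / 8) ^ 2 = n * v * (n ^ 3 * v / 64) := by ring
    have h3 : 1 ≤ n ^ 3 * v / 64 := by nlinarith
    have h4 : n * v * 1 ≤ n * v * (n ^ 3 * v / 64) :=
      mul_le_mul_of_nonneg_left h3 (by positivity)
    linarith
  have hnv0 : 0 ≤ n * v := by positivity
  calc 10 * (n * v) ≤ x ^ 4 * x ^ 2 := mul_le_mul (by linarith) hnv hnv0 (by positivity)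
    _ = x ^ 6 := by ring

theorem five_mul_le_pow {n v x : ℝ} (hn : 4 ≤ n) (hv : 2 ≤ v) (hx : n ^ 2 * v / 20 ≤ x) :
    8 / 5 ≤ x ∧ 5 * (n * v) ≤ x ^ 8 := by
  have hn3 : 64 ≤ n ^ 3 := by
    have := pow_le_pow_left₀ (by norm_num) hn 3
    linarith
  have hn2 : 16 ≤ n ^ 2 := by
    have := pow_le_pow_left₀ (by norm_num) hn 2
    linarith
  have hy2 : 8 / 5 ≤ n ^ 2 * v / 20 := by nlinarith
  refine ⟨hy2.trans hx, ?_⟩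
  have hy6 : 16 ≤ x ^ 6 := by
    have := pow_le_pow_left₀ (by norm_num) (hy2.trans hx) 6
    linarith
  have hnv : 8 / 25 * (n * v) ≤ x ^ 2 := by
    have h1 := pow_le_pow_left₀ (by linarith) hx 2
    have h2 : (n ^ 2 * v / 20) ^ 2 = n * v * (n ^ 3 * v / 400) := by ring
    have h3 : 8 / 25 ≤ n ^ 3 * v / 400 := by nlinarith
    have h4 : n * v * (8 / 25) ≤ n * v * (n ^ 3 * v / 400) :=
      mul_le_mul_of_nonneg_left h3 (by positivity)
    linarith
  have hnv0 : 0 ≤ n * v := by positivity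
  calc 5 * (n * v) ≤ 16 * (8 / 25 * (n * v)) := by linarith
    _ ≤ x ^ 6 * x ^ 2 := mul_le_mul hy6 hnv (by positivity) (by positivity)
    _ = x ^ 8 := by ring

/-- The chaining bound at resolution `2 ^ J ≥ n` is of the order required. -/
theorem chaining_bound_le {n : ℕ} (hn : 4 ≤ n) {x X ρ R : ℝ} (hx : 8 / 5 ≤ x) (hX : 1 < X)
    (hXx : X ≤ x ^ 16) (hρ : 0 ≤ ρ) (hρR : ρ ≤ 60 * R) :
    ((Nat.log 2 n + 1 : ℕ) : ℝ) * (10 * ρ * Real.sqrt (Real.log X / n)) +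
        2 * ρ / 2 ^ (Nat.log 2 n + 1) ≤
      10000 / Real.sqrt n * R * Real.sqrt (Real.logb 2 x) * Real.log n := by
  have hn' : (4 : ℝ) ≤ n := by exact_mod_cast hn
  have hx0 : 0 < x := by linarith
  have hlog2 : 0 < Real.log 2 := Real.log_pos (by norm_num)
  set L := Real.logb 2 x with hL
  have hL1 : 1 / 2 ≤ L := by
    rw [hL, Real.le_logb_iff_rpow_le (by norm_num) hx0, ← Real.sqrt_eq_rpow,
      Real.sqrt_le_left hx0.le]
    nlinarith
  have hLx : Real.log x = L * Real.log 2 := by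
    rw [hL, Real.logb]
    field_simp
  have hlogX : Real.log X ≤ 16 * L := by
    calc Real.log X ≤ Real.log (x ^ 16) := Real.log_le_log (by linarith) hXx
      _ = 16 * (L * Real.log 2) := by rw [Real.log_pow, hLx]; norm_num
      _ ≤ 16 * (L * 1) := by
          gcongr
          linarith [Real.log_two_lt_d9]
      _ = _ := by ring
  have hlogn : 1 ≤ Real.log n := by
    have h4 : Real.log 4 ≤ Real.log n := Real.log_le_log (by norm_num) hn'
    have : Real.log 4 = 2 * Real.log 2 := by
      rw [show (4 : ℝ) = 2 ^ 2 by norm_num, Real.log_pow]; norm_num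
    linarith [Real.log_two_gt_d9]
  have hJ : ((Nat.log 2 n + 1 : ℕ) : ℝ) ≤ 3 * Real.log n := by
    have h1 : (Nat.log 2 n : ℝ) * Real.log 2 ≤ Real.log n := by
      rw [← Real.log_pow]
      refine Real.log_le_log (by positivity) ?_
      exact_mod_cast Nat.pow_log_le_self 2 (by omega)
    push_cast
    nlinarith [Real.log_two_gt_d9]
  have hsn : 2 ≤ Real.sqrt n := by
    rw [Real.le_sqrt (by norm_num) (by linarith)]
    linarith
  have hsqL : 1 / 2 ≤ Real.sqrt L := by
    rw [Real.le_sqrt (by norm_num) (by linarith)]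
    linarith
  have hsq : Real.sqrt (Real.log X / n) ≤ 4 * Real.sqrt L / Real.sqrt n := by
    rw [Real.sqrt_div' _ (by linarith)]
    gcongr
    rw [Real.sqrt_le_left (by positivity), mul_pow, Real.sq_sqrt (by linarith)]
    linarith
  have h2J : Real.sqrt n ≤ 2 ^ (Nat.log 2 n + 1) := by
    have h1 : (n : ℝ) ≤ 2 ^ (Nat.log 2 n + 1) := by
      exact_mod_cast (Nat.lt_pow_succ_log_self (by norm_num) n).le
    have h2 : Real.sqrt n ≤ n := by
      rw [Real.sqrt_le_left (by linarith)]
      nlinarith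
    linarith
  have hR : 0 ≤ R := by linarith
  calc _ ≤ 3 * Real.log n * (10 * ρ * (4 * Real.sqrt L / Real.sqrt n)) + 2 * ρ / Real.sqrt n := by
        gcongr
    _ = ρ / Real.sqrt n * (120 * (Real.sqrt L * Real.log n) + 2) := by ring
    _ ≤ ρ / Real.sqrt n * (124 * (Real.sqrt L * Real.log n)) := by
        gcongr
        nlinarith
    _ ≤ 60 * R / Real.sqrt n * (124 * (Real.sqrt L * Real.log n)) := by gcongr
    _ = 7440 * (R / Real.sqrt n * (Real.sqrt L * Real.log n)) := by ring
    _ ≤ 10000 * (R / Real.sqrt n * (Real.sqrt L * Real.log n)) := by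
        gcongr
        norm_num
    _ = _ := by ring

theorem le_capacity {w : ℕ} {a₁ a₂ aStar b₀ b₁ γ : ℝ} (ha₁ : 0 < a₁) (ha₂ : 0 < a₂)
    (hb₀ : 0 < b₀) (hb₁ : 0 < b₁) (hγ : 0 < γ) :
    b₀ * a₁ * max (1 / b₁) (Real.sqrt w * aStar / γ) ≤ capacity w a₁ a₂ aStar b₀ b₁ γ ∧
      b₁ * a₂ / γ ≤ capacity w a₁ a₂ aStar b₀ b₁ γ := by
  have hα : 0 ≤ b₀ * a₁ * max (1 / b₁) (Real.sqrt w * aStar / γ) :=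
    mul_nonneg (by positivity) (le_trans (by positivity) (le_max_left _ _))
  have hβ : 0 ≤ b₁ * a₂ / γ := by positivity
  have key : ∀ y : ℝ, 0 ≤ y → (y ^ ((2 : ℝ) / 3)) ^ ((3 : ℝ) / 2) = y := fun y hy => by
    rw [← Real.rpow_mul hy]
    norm_num
  have h1 := Real.rpow_nonneg hα ((2 : ℝ) / 3)
  have h2 := Real.rpow_nonneg hβ ((2 : ℝ) / 3)
  constructor
  · calc _ = _ := (key _ hα).symm
      _ ≤ _ := Real.rpow_le_rpow h1 (by linarith) (by norm_num)
  · calc _ = _ := (key _ hβ).symm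
      _ ≤ _ := Real.rpow_le_rpow h2 (by linarith) (by norm_num)

/-- For at most three samples the deviation term alone exceeds `1`. -/
theorem one_le_deviation {n : ℕ} (hn0 : 0 < n) (hn : n ≤ 3) {δ : ℝ} (hδ : 0 < δ) (hδ1 : δ < 1) :
    1 ≤ 3 * Real.sqrt (Real.log (2 / δ) / (2 * n)) := by
  have hn0' : (0 : ℝ) < n := by exact_mod_cast hn0
  have hn' : (n : ℝ) ≤ 3 := by exact_mod_cast hn
  have hlog : Real.log 2 ≤ Real.log (2 / δ) :=
    Real.log_le_log (by norm_num) (by rw [le_div_iff₀ hδ]; linarith)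
  have : 1 / 3 ≤ Real.sqrt (Real.log (2 / δ) / (2 * n)) := by
    rw [Real.le_sqrt (by norm_num) (div_nonneg (by linarith [Real.log_two_gt_d9]) (by linarith)),
      le_div_iff₀ (by linarith)]
    linarith [Real.log_two_gt_d9]
  linarith

end Numerics

section Reduction

variable {C m dp P w n : ℕ}

/-- Either the first layer is kept, or it varies so little that it may be frozen. -/
theorem exists_reduced_first_layer (M1 : Matrix (Fin m) (Fin dp) ℝ) (P w n : ℕ)
    {a₁ aStar b₀ γ : ℝ} (ha₁ : 0 < a₁) (hb₀ : 0 < b₀) (hγ : 0 < γ) :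
    ∃ (S : Set (Matrix (Fin m) (Fin dp) ℝ)) (X r : ℝ),
      (∀ A ∈ S, ∀ f, l2 (A f - M1 f) ≤ a₁) ∧
      (∀ {ι : Type} (A : ι → Matrix (Fin m) (Fin dp) ℝ), (∀ i, A i ∈ S) →
        ∀ u : Fin n ⊕ Fin n → Fin P → Fin dp → ℝ, (∀ k o, l2 (u k o) ≤ b₀) →
          FirstLayerCovers u A X r) ∧
      (∀ A, rowSum21 (A - M1) ≤ a₁ → ∃ B ∈ S, ∃ e : Fin m → ℝ,
        (∀ f v, l2 v ≤ b₀ → |(A f - B f) ⬝ᵥ v| ≤ e f) ∧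
          aStar * Real.sqrt w * l2 e ≤ γ / 8) ∧
      ((X = 1 ∧ r = 0) ∨ (1 / 8 ≤ aStar * Real.sqrt w * (a₁ * b₀) / γ ∧
        X = (m + 1) * (2 * ((2 * n) * P) + 1) ∧ r = 2 * a₁ * b₀)) := by
  have hrow : ∀ (A B : Matrix (Fin m) (Fin dp) ℝ) f, l2 (A f - B f) ≤ rowSum21 (A - B) :=
    fun A B f => Finset.single_le_sum (f := fun f => l2 ((A - B) f))
      (fun _ _ => l2_nonneg _) (Finset.mem_univ f)
  by_cases h : 1 / 8 ≤ aStar * Real.sqrt w * (a₁ * b₀) / γ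
  · refine ⟨{A | rowSum21 (A - M1) ≤ a₁}, _, _, fun A hA f => (hrow A M1 f).trans hA, ?_, ?_,
      Or.inr ⟨h, rfl, rfl⟩⟩
    · intro ι A hA u hu
      have := firstLayerCovers_of_rowSum21_le u A M1 ha₁ hb₀ hu hA
      simpa [two_mul] using this
    · intro A hA
      exact ⟨A, hA, 0, by simp, by simp [l2]; positivity⟩
  · refine ⟨{M1}, 1, 0, ?_, ?_, ?_, Or.inl ⟨rfl, rfl⟩⟩
    · rintro A rfl f
      simp [l2, ha₁.le]
    · intro ι A hA u _
      exact firstLayerCovers_const u A M1 hA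
    · intro A hA
      refine ⟨M1, rfl, fun f => l2 (A f - M1 f) * b₀, fun f v hv => (abs_dotProduct_le _ _).trans
        (mul_le_mul_of_nonneg_left hv (l2_nonneg _)), ?_⟩
      have hl : l2 (fun f => l2 (A f - M1 f) * b₀) ≤ a₁ * b₀ := by
        refine (l2_le_sum_abs _ fun f => mul_nonneg (l2_nonneg _) hb₀.le).trans ?_
        rw [← Finset.sum_mul]
        exact mul_le_mul_of_nonneg_right hA hb₀.le
      rw [not_le, div_lt_iff₀ hγ] at h
      rcases le_or_gt 0 aStar with ha | ha
      · have := mul_le_mul_of_nonneg_left hl (mul_nonneg ha (Real.sqrt_nonneg w))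
        linarith
      · have := mul_nonneg (mul_nonneg (neg_nonneg.2 ha.le) (Real.sqrt_nonneg w))
          (l2_nonneg fun f => l2 (A f - M1 f) * b₀)
        linarith

/-- Either the second layer is kept, or it varies so little that it may be frozen at `A₀`. -/
theorem exists_reduced_second_layer (M2 A₀ : Matrix (Fin C) (Fin m × Fin w) ℝ) (n : ℕ)
    {a₂ aStar b₁ γ : ℝ} (ha₂ : 0 < a₂) (hb₁ : 0 < b₁) (hγ : 0 < γ)
    (hA₀ : frob (A₀ - M2) ≤ a₂) (hA₀' : ∀ c, l2 (A₀ c) ≤ aStar) :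
    ∃ (S : Set (Matrix (Fin C) (Fin m × Fin w) ℝ)) (X r : ℝ),
      (∀ A ∈ S, ∀ c, l2 (A c) ≤ aStar) ∧
      (∀ {ι : Type} (A : ι → Matrix (Fin C) (Fin m × Fin w) ℝ), (∀ i, A i ∈ S) →
          SecondLayerCovers (Fin n ⊕ Fin n) b₁ A X r) ∧
      (∀ A, frob (A - M2) ≤ a₂ → (∀ c, l2 (A c) ≤ aStar) → ∃ B ∈ S,
        ∀ c v, l2 v ≤ b₁ → |(A c - B c) ⬝ᵥ v| ≤ γ / 10) ∧
      ((X = 1 ∧ r = 0) ∨ (1 / 20 ≤ b₁ * a₂ / γ ∧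
        X = 2 * (C * (2 * n)) + 1 ∧ r = a₂ * b₁)) := by
  by_cases h : 1 / 20 ≤ b₁ * a₂ / γ
  · refine ⟨{A | frob (A - M2) ≤ a₂ ∧ ∀ c, l2 (A c) ≤ aStar}, _, _, fun A hA => hA.2, ?_, ?_,
      Or.inr ⟨h, rfl, rfl⟩⟩
    · intro ι A hA
      have := secondLayerCovers_of_frob_le (κ := Fin n ⊕ Fin n) ha₂ hb₁ A M2 fun i => (hA i).1
      simpa [two_mul] using this
    · intro A hA hA'
      exact ⟨A, ⟨hA, hA'⟩, by simp; intros; positivity⟩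
  · refine ⟨{A₀}, 1, 0, ?_, ?_, ?_, Or.inl ⟨rfl, rfl⟩⟩
    · rintro A rfl
      exact hA₀'
    · intro ι A hA
      exact secondLayerCovers_const b₁ A A₀ hA
    · intro A hA _
      refine ⟨A₀, rfl, fun c v hv => ?_⟩
      have hsplit : (A c - A₀ c) ⬝ᵥ v = (A c - M2 c) ⬝ᵥ v - (A₀ c - M2 c) ⬝ᵥ v := by
        simp only [sub_dotProduct]
        ring
      have hbound : ∀ B : Matrix (Fin C) (Fin m × Fin w) ℝ, frob (B - M2) ≤ a₂ →
          |(B c - M2 c) ⬝ᵥ v| ≤ a₂ * b₁ := fun B hB => (abs_dotProduct_le _ _).trans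
        (mul_le_mul ((l2_row_le_frob (B - M2) c).trans hB) hv (l2_nonneg _) ha₂.le)
      rw [not_le, div_lt_iff₀ hγ] at h
      rw [hsplit]
      refine (abs_sub _ _).trans ?_
      linarith [hbound A hA, hbound A₀ hA₀]

end Reduction

/-- The radius of the reduced class is at most a multiple of the capacity, and the logarithm of its
covering base is controlled by the logarithm in the bound. -/
theorem reduced_chaining_bound_le {C m P w n : ℕ} (hC : 1 < C) (hm : 0 < m)
    (hP : 0 < P) (hn : 4 ≤ n) {a₁ a₂ aStar b₀ b₁ γ : ℝ} (ha₁ : 0 < a₁) (ha₂ : 0 < a₂)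
    (hb₀ : 0 < b₀) (hb₁ : 0 < b₁) (hγ : 0 < γ) {X₁ X₂ r₁ r₂ : ℝ}
    (h₁ : (X₁ = 1 ∧ r₁ = 0) ∨ (1 / 8 ≤ aStar * Real.sqrt w * (a₁ * b₀) / γ ∧
      X₁ = (m + 1) * (2 * ((2 * n) * P) + 1) ∧ r₁ = 2 * a₁ * b₀))
    (h₂ : (X₂ = 1 ∧ r₂ = 0) ∨ (1 / 20 ≤ b₁ * a₂ / γ ∧
      X₂ = 2 * (C * (2 * n)) + 1 ∧ r₂ = a₂ * b₁))
    {ρ : ℝ} (hρ : ρ = 20 / γ * (aStar * Real.sqrt w * r₁ + r₂)) (hρ0 : 0 ≤ ρ) :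
    ((Nat.log 2 n + 1 : ℕ) : ℝ) * (10 * ρ * Real.sqrt (Real.log (2 * (X₁ * X₂)) / n)) +
        2 * ρ / 2 ^ (Nat.log 2 n + 1) ≤
      10000 / Real.sqrt n * capacity w a₁ a₂ aStar b₀ b₁ γ *
        Real.sqrt (Real.logb 2 ((n : ℝ) ^ 2 * logArg w C (m * P) a₁ a₂ aStar b₀ b₁ γ)) *
          Real.log n := by
  have hn' : (4 : ℝ) ≤ n := by exact_mod_cast hn
  have hm' : (1 : ℝ) ≤ m := by exact_mod_cast hm
  have hP' : (1 : ℝ) ≤ P := by exact_mod_cast hP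
  have hC' : (2 : ℝ) ≤ C := by exact_mod_cast hC
  have hW : (1 : ℝ) ≤ (m * P : ℕ) := by
    push_cast
    nlinarith
  obtain ⟨hcap₁, hcap₂⟩ := le_capacity (w := w) (aStar := aStar) ha₁ ha₂ hb₀ hb₁ hγ
  set R := capacity w a₁ a₂ aStar b₀ b₁ γ with hR
  set D := logArg w C (m * P) a₁ a₂ aStar b₀ b₁ γ with hD
  set α := b₀ * a₁ * max (1 / b₁) (Real.sqrt w * aStar / γ) with hα
  set β := b₁ * a₂ / γ with hβ
  have hβ0 : 0 < β := by positivity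
  have hα' : aStar * Real.sqrt w * (a₁ * b₀) / γ ≤ α := by
    calc _ = b₀ * a₁ * (Real.sqrt w * aStar / γ) := by ring
      _ ≤ _ := mul_le_mul_of_nonneg_left (le_max_right _ _) (by positivity)
  have hDα : α * (m * P : ℕ) ≤ D := by
    refine le_trans (le_of_eq ?_) (le_max_left _ _)
    rw [hα]
    ring
  have hDβ : β * C ≤ D := by
    refine le_trans (le_of_eq ?_) (le_max_right _ _)
    rw [hβ]
    ring
  have hα0 : 0 ≤ α := by
    have : (0 : ℝ) ≤ max (1 / b₁) (Real.sqrt w * aStar / γ) :=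
      le_trans (by positivity) (le_max_left _ _)
    positivity
  have hR0 : 0 ≤ R := hα0.trans hcap₁
  have hfirst : 20 / γ * (aStar * Real.sqrt w * (2 * a₁ * b₀)) ≤ 40 * R := by
    calc _ = 40 * (aStar * Real.sqrt w * (a₁ * b₀) / γ) := by ring
      _ ≤ 40 * R := by linarith
  have hsecond : 20 / γ * (a₂ * b₁) ≤ 20 * R := by
    calc _ = 20 * β := by rw [hβ]; ring
      _ ≤ 20 * R := by linarith
  have hbase₁ : 1 / 8 ≤ aStar * Real.sqrt w * (a₁ * b₀) / γ →
      2 ≤ (n : ℝ) ^ 2 * D ∧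
        ((m : ℝ) + 1) * (2 * ((2 * n) * P) + 1) ≤ ((n : ℝ) ^ 2 * D) ^ 6 := by
    intro h
    have hx : (n : ℝ) ^ 2 * (m * P : ℕ) / 8 ≤ (n : ℝ) ^ 2 * D := by
      rw [mul_div_assoc]
      refine mul_le_mul_of_nonneg_left ?_ (by positivity)
      have : 1 / 8 * ((m * P : ℕ) : ℝ) ≤ α * (m * P : ℕ) := by gcongr; linarith
      linarith
    refine ⟨(ten_mul_le_pow hn' hW hx).1, le_trans ?_ (ten_mul_le_pow hn' hW hx).2⟩
    have h1 : (m : ℝ) + 1 ≤ 2 * m := by linarith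
    have h2 : 2 * ((2 * n) * P) + 1 ≤ 5 * ((n : ℝ) * P) := by nlinarith
    calc ((m : ℝ) + 1) * (2 * ((2 * n) * P) + 1) ≤ 2 * m * (5 * (n * P)) := by gcongr
      _ = _ := by push_cast; ring
  have hbase₂ : 1 / 20 ≤ β → 8 / 5 ≤ (n : ℝ) ^ 2 * D ∧
      2 * ((C : ℝ) * (2 * n)) + 1 ≤ ((n : ℝ) ^ 2 * D) ^ 8 := by
    intro h
    have hx : (n : ℝ) ^ 2 * C / 20 ≤ (n : ℝ) ^ 2 * D := by
      rw [mul_div_assoc]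
      refine mul_le_mul_of_nonneg_left ?_ (by positivity)
      have : 1 / 20 * (C : ℝ) ≤ β * C := by gcongr
      linarith
    refine ⟨(five_mul_le_pow hn' hC' hx).1, le_trans ?_ (five_mul_le_pow hn' hC' hx).2⟩
    nlinarith
  have hlarge : 8 / 5 ≤ (n : ℝ) ^ 2 * D → X₁ ≤ ((n : ℝ) ^ 2 * D) ^ 6 →
      X₂ ≤ ((n : ℝ) ^ 2 * D) ^ 8 → 1 ≤ X₁ → 1 ≤ X₂ → ρ ≤ 60 * R →
      ((Nat.log 2 n + 1 : ℕ) : ℝ) * (10 * ρ * Real.sqrt (Real.log (2 * (X₁ * X₂)) / n)) +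
        2 * ρ / 2 ^ (Nat.log 2 n + 1) ≤
      10000 / Real.sqrt n * R * Real.sqrt (Real.logb 2 ((n : ℝ) ^ 2 * D)) * Real.log n := by
    intro hx hx₁ hx₂ h1 h2 hρR
    refine chaining_bound_le hn hx (by nlinarith) ?_ hρ0 hρR
    have h3 : 2 ≤ ((n : ℝ) ^ 2 * D) ^ 2 := by nlinarith
    calc 2 * (X₁ * X₂) ≤
          ((n : ℝ) ^ 2 * D) ^ 2 * (((n : ℝ) ^ 2 * D) ^ 6 * ((n : ℝ) ^ 2 * D) ^ 8) := by
          gcongr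
      _ = _ := by ring
  have hone : ∀ {x : ℝ} (k : ℕ), 8 / 5 ≤ x → 1 ≤ x ^ k := fun k hx =>
    one_le_pow₀ (by linarith)
  have hone₁ : 1 ≤ ((m : ℝ) + 1) * (2 * ((2 * n) * P) + 1) :=
    one_le_mul_of_one_le_of_one_le (by linarith) (le_add_of_nonneg_left (by positivity))
  have hone₂ : 1 ≤ 2 * ((C : ℝ) * (2 * n)) + 1 := le_add_of_nonneg_left (by positivity)
  rcases h₁ with ⟨rfl, rfl⟩ | ⟨hs₁, rfl, rfl⟩ <;> rcases h₂ with ⟨rfl, rfl⟩ | ⟨hs₂, rfl, rfl⟩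
  · have : ρ = 0 := by rw [hρ]; ring
    rw [this]
    have : 0 ≤ Real.log n := Real.log_nonneg (by linarith)
    simp only [mul_zero, zero_mul, zero_div, add_zero]
    positivity
  · obtain ⟨hx, hX₂⟩ := hbase₂ hs₂
    refine hlarge hx (hone 6 hx) hX₂ le_rfl hone₂ ?_
    rw [hρ, mul_zero, zero_add]
    linarith
  · obtain ⟨hx, hX₁⟩ := hbase₁ hs₁
    have hx' : 8 / 5 ≤ (n : ℝ) ^ 2 * D := by linarith
    refine hlarge hx' hX₁ (hone 8 hx') hone₁ le_rfl ?_
    rw [hρ, add_zero]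
    linarith
  · obtain ⟨hx, hX₁⟩ := hbase₁ hs₁
    obtain ⟨hx', hX₂⟩ := hbase₂ hs₂
    refine hlarge hx' hX₁ hX₂ hone₁ hone₂ ?_
    rw [hρ, mul_add]
    linarith

end TwoLayerConv

/-- Generalisation bound for two-layer convolutional networks. The probability statement bounds
the (outer) probability of the failure event by less than `δ`; `Real.sqrt` is `0` on negative
arguments, so the logarithm enters through its positive part. -/
theorem two_layer_conv_generalisation :
    ∃ 𝒞 : ℝ, 0 < 𝒞 ∧
      ∀ (d C m dp P w n : ℕ), 0 < d → 1 < C → 0 < m → 0 < dp → 0 < P → 0 < w → 0 < n →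
      ∀ (pt : Fin P → Fin dp → Fin d) (pool : Pooling P w)
        (M1 : Matrix (Fin m) (Fin dp) ℝ) (M2 : Matrix (Fin C) (Fin m × Fin w) ℝ)
        (μ : Measure ((Fin d → ℝ) × Fin C)), IsProbabilityMeasure μ →
      ∀ a₁ a₂ aStar b₀ b₁ γ δ : ℝ,
        0 < a₁ → 0 < a₂ → 0 < aStar → 0 < b₀ → 0 < b₁ → 0 < γ → 0 < δ → δ < 1 →
        (∀ᵐ p ∂μ, patchNorm pt p.1 ≤ b₀) →
        (Measure.pi fun _ : Fin n => μ)
          {s : Fin n → (Fin d → ℝ) × Fin C |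
            ¬ ∀ (A1 : Matrix (Fin m) (Fin dp) ℝ) (A2 : Matrix (Fin C) (Fin m × Fin w) ℝ),
              rowSum21 (A1 - M1) ≤ a₁ →
              frob (A2 - M2) ≤ a₂ →
              (∀ c : Fin C, l2 (A2 c) ≤ aStar) →
              (∀ i : Fin n, frob (conv pt A1 (s i).1) ≤ b₁) →
              μ.real (errorSet (net pt pool A1 A2)) ≤
                marginRisk γ (net pt pool A1 A2) s +
                3 * Real.sqrt (Real.log (2 / δ) / (2 * n)) +
                𝒞 / Real.sqrt n * capacity w a₁ a₂ aStar b₀ b₁ γ *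
                  Real.sqrt (Real.logb 2 ((n : ℝ) ^ 2 *
                    logArg w C (m * P) a₁ a₂ aStar b₀ b₁ γ)) *
                  Real.log n} < ENNReal.ofReal δ := by
  refine ⟨10000, by norm_num, ?_⟩
  intro d C m dp P w n _ hC hm _ hP _ hn pt pool M1 M2 μ _ a₁ a₂ aStar b₀ b₁ γ δ ha₁ ha₂ haS hb₀ hb₁
    hγ hδ hδ1 hμ
  have hR0 : 0 ≤ capacity w a₁ a₂ aStar b₀ b₁ γ :=
    le_trans (by positivity) (le_capacity (w := w) (aStar := aStar) ha₁ ha₂ hb₀ hb₁ hγ).2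
  have hlogn : 0 ≤ Real.log n := Real.log_natCast_nonneg n
  have hrisk : ∀ (F : (Fin d → ℝ) → Fin C → ℝ) (s : Fin n → (Fin d → ℝ) × Fin C),
      0 ≤ marginRisk γ F s := fun F s => div_nonneg (Nat.cast_nonneg _) (Nat.cast_nonneg _)
  have hδ' : 0 < ENNReal.ofReal δ := ENNReal.ofReal_pos.2 hδ
  rcases Nat.lt_or_ge 3 n with hn4 | hn3
  swap
  · refine lt_of_le_of_lt (le_of_eq ?_) hδ'
    convert measure_empty (μ := Measure.pi fun _ : Fin n => μ)
    refine Set.eq_empty_of_forall_notMem fun s hs => hs fun A1 A2 _ _ _ _ => ?_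
    have h1 : μ.real (errorSet (net pt pool A1 A2)) ≤ 1 := measureReal_le_one
    have h2 := one_le_deviation hn hn3 hδ hδ1
    have h3 : 0 ≤ 10000 / Real.sqrt n * capacity w a₁ a₂ aStar b₀ b₁ γ *
        Real.sqrt (Real.logb 2 ((n : ℝ) ^ 2 * logArg w C (m * P) a₁ a₂ aStar b₀ b₁ γ)) *
          Real.log n := by positivity
    linarith [hrisk (net pt pool A1 A2) s]
  by_cases hne : ∃ A₀ : Matrix (Fin C) (Fin m × Fin w) ℝ,
      frob (A₀ - M2) ≤ a₂ ∧ ∀ c, l2 (A₀ c) ≤ aStar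
  swap
  · refine lt_of_le_of_lt (le_of_eq ?_) hδ'
    convert measure_empty (μ := Measure.pi fun _ : Fin n => μ)
    exact Set.eq_empty_of_forall_notMem fun s hs => hs fun A1 A2 _ h2 h3 _ =>
      absurd ⟨A2, h2, h3⟩ hne
  obtain ⟨A₀, hA₀, hA₀'⟩ := hne
  obtain ⟨S₁, X₁, r₁, hS₁, hcov₁, hred₁, hcase₁⟩ :=
    exists_reduced_first_layer M1 P w n (aStar := aStar) ha₁ hb₀ hγ
  obtain ⟨S₂, X₂, r₂, hS₂, hcov₂, hred₂, hcase₂⟩ :=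
    exists_reduced_second_layer M2 A₀ n ha₂ hb₁ hγ hA₀ hA₀'
  have hX₁ : 1 ≤ X₁ ∧ 0 ≤ r₁ := by
    rcases hcase₁ with ⟨rfl, rfl⟩ | ⟨_, rfl, rfl⟩
    · simp
    · refine ⟨?_, by positivity⟩
      exact_mod_cast Nat.mul_pos (Nat.succ_pos _) (Nat.succ_pos _)
  have hX₂ : 1 ≤ X₂ ∧ 0 ≤ r₂ := by
    rcases hcase₂ with ⟨rfl, rfl⟩ | ⟨_, rfl, rfl⟩
    · simp
    · refine ⟨?_, by positivity⟩
      exact_mod_cast Nat.succ_pos _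
  have hn' : (0 : ℝ) < n := by exact_mod_cast hn
  have hlogδ : 0 < Real.log (2 / δ) :=
    Real.log_pos (by rw [lt_div_iff₀ hδ]; linarith)
  set t := Real.sqrt (Real.log (2 / δ) / (2 * n)) with ht
  have ht0 : 0 < t := Real.sqrt_pos.2 (by positivity)
  have hexp : Real.exp (-(2 * n * t ^ 2)) = δ / 2 := by
    rw [ht, Real.sq_sqrt (by positivity), mul_div_cancel₀ _ (by positivity), ← Real.log_inv,
      Real.exp_log (by positivity), inv_div]
  set ρ := 20 / γ * (aStar * Real.sqrt w * r₁ + r₂) with hρ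
  have hρ0 : 0 ≤ ρ := by
    have := hX₁.2
    have := hX₂.2
    positivity
  have hdev := measure_exists_loss_deviation_le hC hn pt pool μ hγ hb₀ hb₁ haS hμ S₁ S₂ M1 a₁ hS₁
    hS₂ X₁ X₂ (2 * (X₁ * X₂)) r₁ r₂ (by linarith [hX₁.1]) (by linarith [hX₂.1])
    (by nlinarith [hX₁.1, hX₂.1]) (by nlinarith [hX₁.1, hX₂.1]) hX₁.2 hX₂.2
    (fun u hu => hcov₁ _ (fun p => p.1.2) u hu) (hcov₂ _ fun p => p.2.2) ρ hρ
    (Nat.log 2 n + 1) t ht0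
  have hE := reduced_chaining_bound_le hC hm hP hn4 ha₁ ha₂ hb₀ hb₁ hγ hcase₁ hcase₂ hρ hρ0
  have hbad : (Measure.pi fun _ : Fin n => μ) {s | ¬ ∀ k, patchNorm pt (s k).1 ≤ b₀} = 0 :=
    ae_iff.1 (Filter.eventually_all.2 fun k =>
      (Measure.tendsto_eval_ae_ae (μ := fun _ : Fin n => μ) (i := k)).eventually hμ)
  refine lt_of_le_of_lt (b := ENNReal.ofReal (δ / 2)) ?_
    ((ENNReal.ofReal_lt_ofReal_iff hδ).2 (by linarith))
  rw [← hexp]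
  refine le_trans (measure_mono ?_) ((measure_union_le _ _).trans
    ((add_le_add hbad.le hdev).trans (zero_add _).le))
  intro s hs
  by_cases hgood : ∀ k, patchNorm pt (s k).1 ≤ b₀
  swap
  · exact Or.inl hgood
  right
  by_contra hnot
  refine hs fun A1 A2 h1 h2 h3 h4 => ?_
  obtain ⟨B1, hB1, e, he, hle⟩ := hred₁ A1 h1
  obtain ⟨B2, hB2, hv⟩ := hred₂ A2 h2 h3
  have hclose : ∀ x : Fin d → ℝ, patchNorm pt x ≤ b₀ → ∀ c,
      |score pt pool b₁ A1 A2 x c - score pt pool b₁ B1 B2 x c| ≤ 9 / 40 * γ := by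
    intro x hx c
    refine (abs_score_sub_le pt pool hb₁ A1 B1 A2 B2 h3 x e (γ / 10)
      (fun f o => he f _ (l2_patch_le pt hx o)) c (hv c _ (l2_clip_le hb₁ _))).trans ?_
    linarith
  have herr := error_le_integral_loss hC pt pool μ hγ hb₁ hμ A1 B1 A2 B2 hclose
  have hemp := sum_loss_div_le_marginRisk hC pt pool hγ hb₁ A1 B1 A2 B2 hclose s hgood h4
  have hlt : ∫ p, loss pt pool γ b₁ B1 B2 p ∂μ <
      (∑ k, loss pt pool γ b₁ B1 B2 (s k)) / n +
        (((Nat.log 2 n + 1 : ℕ) : ℝ) *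
          (10 * ρ * Real.sqrt (Real.log (2 * (X₁ * X₂)) / n)) + 2 * ρ / 2 ^ (Nat.log 2 n + 1)) +
        3 * t := by
    by_contra! hge
    exact hnot ⟨B1, hB1, B2, hB2, hge⟩
  linarith
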